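/- Let 0 < k ≤ l, let Y be a random variable with the Gamma(k) distribution, and let X be a positive random variable whose density is hyperbolically monotone of order l (HM_l), with Y and X independent. Then the distribution of the quotient Y/X is a generalized gamma convolution (GGC). -/

import Mathlib

open MeasureTheory ProbabilityTheory Real

noncomputable section

/-- A probability measure on `[0,∞)` is a generalized gamma convolution (GGC) if its
Laplace transform has the Thorin form. -/
def IsGGC (μ : Measure ℝ) : Prop :=
  IsProbabilityMeasure μ ∧ μ (Set.Iio 0) = 0 ∧
  ∃ (a : ℝ) (U : Measure ℝ),
    0 ≤ a ∧ U (Set.Iic 0) = 0 ∧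
    (∀ r s : ℝ, 0 < r → U (Set.Icc r s) < ⊤) ∧
    (∫⁻ t in Set.Ioc (0:ℝ) 1, ENNReal.ofReal |Real.log t| ∂U) < ⊤ ∧
    (∫⁻ t in Set.Ici (1:ℝ), ENNReal.ofReal t⁻¹ ∂U) < ⊤ ∧
    ∀ s : ℝ, 0 ≤ s →
      (∫ x, Real.exp (-s * x) ∂μ) =
        Real.exp (-(a * s) + ∫ t in Set.Ioi (0:ℝ), Real.log (t / (t + s)) ∂U)

/-- A probability density `f` on `(0,∞)` is hyperbolically monotone of order `k` (`HM_k`). -/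
def IsHMDensity (k : ℝ) (f : ℝ → ℝ) : Prop :=
  (∀ x, 0 ≤ f x) ∧ (∫⁻ x in Set.Ioi (0:ℝ), ENNReal.ofReal (f x)) = 1 ∧
  ∀ u : ℝ, 0 < u → ∃ H : Measure ℝ,
    ∀ v : ℝ, 0 < v →
      ENNReal.ofReal (f (u * v) * f (u / v)) =
        ∫⁻ lam in Set.Ioi (v + v⁻¹), ENNReal.ofReal ((lam - (v + v⁻¹)) ^ (k - 1)) ∂H

/-- The random variable `X` has density `f` (with respect to Lebesgue measure) on `(0,∞)`. -/
def HasDensityOn {Ω : Type*} [MeasurableSpace Ω] (P : Measure Ω) (X : Ω → ℝ)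
    (f : ℝ → ℝ) : Prop :=
  Measure.map X P =
    (volume.restrict (Set.Ioi (0:ℝ))).withDensity (fun x => ENNReal.ofReal (f x))

/-- The `Gamma(k, r)` distribution, with density `r^k Γ(k)⁻¹ x^(k-1) e^(-r x)` on `(0,∞)`. -/
def gammaMeas (k r : ℝ) : Measure ℝ :=
  (volume.restrict (Set.Ioi (0:ℝ))).withDensity
    (fun x => ENNReal.ofReal (r ^ k / Real.Gamma k * x ^ (k - 1) * Real.exp (-(r * x))))

/-- `g` is completely monotone on `(0,∞)`:  infinitely differentiable with
`(-1)^n g^(n)(T) ≥ 0` for all `T > 0` and `n ≥ 0`. -/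
def CompletelyMonotoneOn (g : ℝ → ℝ) : Prop :=
  ContDiffOn ℝ (⊤ : ℕ∞) g (Set.Ioi 0) ∧
  ∀ (n : ℕ) (T : ℝ), 0 < T →
    0 ≤ (-1 : ℝ) ^ n * iteratedDerivWithin n g (Set.Ioi 0) T

end
open Set Filter Topology in
lemma exists_pos_measure_bounded (F : ℝ → ℝ) 
    (hF : ∀ c, LowerSemicontinuous fun x => F x * F (c - x))
    {δ : ℝ} (hδ : 0 < δ) {E : Set ℝ} (hE : MeasurableSet E) (hE0 : volume E ≠ 0)
    (hEF : ∀ x ∈ E, δ ≤ F x) :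
    ∃ (M : ℝ) (K : Set ℝ), MeasurableSet K ∧ volume K ≠ 0 ∧ ∀ x ∈ K, δ ≤ F x ∧ F x ≤ M := by
  obtain ⟨c, hc⟩ : ∃ c : ℝ, volume (E ∩ (fun x => c - x) ⁻¹' E) ≠ 0 := by
    by_contra! h
    have h1 : ∫⁻ c : ℝ, ∫⁻ x : ℝ, E.indicator 1 x * E.indicator 1 (c - x) = 0 := by
      rw [lintegral_eq_zero_iff' (by
        apply AEMeasurable.lintegral_prod_right'
          (f := fun p : ℝ × ℝ => E.indicator (1 : ℝ → ENNReal) p.2 * E.indicator 1 (p.1 - p.2))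
        have := (measurable_one (α := ENNReal) (β := ℝ)).indicator hE
        fun_prop)]
      refine Eventually.of_forall fun c => ?_
      have : ∀ x : ℝ, E.indicator (1 : ℝ → ENNReal) x * E.indicator 1 (c - x)
          = (E ∩ (fun x => c - x) ⁻¹' E).indicator 1 x := by
        intro x
        by_cases h1 : x ∈ E <;> by_cases h2 : c - x ∈ E <;> simp [h1, h2]
      simp only [this]
      rw [lintegral_indicator_one (hE.inter (hE.preimage (by fun_prop)))]
      exact h c
    rw [lintegral_lintegral_swap (by
        have := (measurable_one (α := ENNReal) (β := ℝ)).indicator hE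
        apply Measurable.aemeasurable
        unfold Function.uncurry
        fun_prop)] at h1
    have h2 : ∀ x : ℝ, ∫⁻ c : ℝ, E.indicator (1 : ℝ → ENNReal) x * E.indicator 1 (c - x)
        = E.indicator 1 x * volume E := by
      intro x
      rw [lintegral_const_mul _ (by
        have := (measurable_one (α := ENNReal) (β := ℝ)).indicator hE
        fun_prop), lintegral_sub_right_eq_self (fun c => E.indicator (1 : ℝ → ENNReal) c),
        lintegral_indicator_one hE]
    simp only [h2] at h1
    rw [lintegral_mul_const _ (measurable_one.indicator hE), lintegral_indicator_one hE] at h1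
    simp [hE0] at h1
  have hU : (E ∩ (fun x => c - x) ⁻¹' E)
      ⊆ ⋃ n : ℕ, (E ∩ (fun x => c - x) ⁻¹' E) ∩ {x | F x * F (c - x) ≤ n} := by
    intro x hx
    obtain ⟨n, hn⟩ := exists_nat_ge (F x * F (c - x))
    exact mem_iUnion.2 ⟨n, hx, hn⟩
  obtain ⟨n, hn⟩ : ∃ n : ℕ,
      volume ((E ∩ (fun x => c - x) ⁻¹' E) ∩ {x | F x * F (c - x) ≤ n}) ≠ 0 := by
    by_contra! h
    exact hc (measure_mono_null hU (measure_iUnion_null h))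
  refine ⟨n / δ, _, ?_, hn, ?_⟩
  · exact (hE.inter (hE.preimage (by fun_prop))).inter
      (measurableSet_le (hF c).measurable measurable_const)
  · rintro x ⟨⟨h1, h2⟩, h3⟩
    refine ⟨hEF x h1, ?_⟩
    rw [le_div_iff₀ hδ]
    have := hEF x h1
    have h2' := hEF _ h2
    have h3' : F x * F (c - x) ≤ n := h3
    nlinarith

open Set Filter Topology in
lemma lowerSemicontinuous_of_antidiagonal_mul (F : ℝ → ℝ) (hF0 : ∀ x, 0 ≤ F x)
    (hF : ∀ c, LowerSemicontinuous fun x => F x * F (c - x))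
    {δ : ℝ} (hδ : 0 < δ) {E : Set ℝ} (hE : MeasurableSet E) (hE0 : volume E ≠ 0)
    (hEF : ∀ x ∈ E, δ ≤ F x) :
    LowerSemicontinuous F := by
  obtain ⟨M, K', hK', hK'0, hK'F⟩ := exists_pos_measure_bounded F hF hδ hE hE0 hEF
  obtain ⟨K, hKm, hK0, hKtop, hKF⟩ : ∃ K : Set ℝ, MeasurableSet K ∧ volume K ≠ 0 ∧
      volume K ≠ ⊤ ∧ ∀ x ∈ K, δ ≤ F x ∧ F x ≤ M := by
    obtain ⟨K, hKK, hKc, h0⟩ :=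
      MeasurableSet.exists_lt_isCompact (μ := volume) hK' (pos_iff_ne_zero.2 hK'0)
    exact ⟨K, hKc.measurableSet, h0.ne', hKc.measure_lt_top.ne, fun x hx => hK'F x (hKK hx)⟩
  intro x0 t0 ht0
  by_contra hcon
  have hcon' : ∃ᶠ y in 𝓝 x0, F y ≤ t0 := by
    intro h; apply hcon; filter_upwards [h] with y hy using not_le.1 hy
  obtain ⟨u, hu, hut⟩ := exists_seq_forall_of_frequently hcon'
  have hFx0 : 0 < F x0 := lt_of_le_of_lt ((hF0 _).trans (hut 0)) ht0
  obtain ⟨t, ht, htx, hut'⟩ : ∃ t, 0 < t ∧ t < F x0 ∧ ∀ n, F (u n) ≤ t :=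
    ⟨max t0 (F x0 / 2), lt_max_of_lt_right (by linarith), max_lt ht0 (by linarith),
      fun n => (hut n).trans (le_max_left _ _)⟩
  obtain ⟨κ, hκ1, hκ2⟩ := exists_between ((one_lt_div ht).2 htx)
  rw [lt_div_iff₀ ht] at hκ2
  set h : ℕ → ℝ := fun n => u n - x0 with hh
  have hh0 : Tendsto h atTop (𝓝 0) := by
    simpa [hh] using hu.sub_const x0
  have key : ∀ y, 0 < F y → ∀ᶠ n in atTop, κ * F y ≤ F (y - h n) := by
    intro y hy
    have h1 := hF (x0 + y) x0 (κ * t * F y) (by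
      simp only [add_sub_cancel_left]; gcongr)
    filter_upwards [hu.eventually h1] with n hn
    have e : x0 + y - u n = y - h n := by simp only [hh]; ring
    rw [e] at hn
    have h2 : F (u n) * F (y - h n) ≤ t * F (y - h n) := 
      mul_le_mul_of_nonneg_right (hut' n) (hF0 _)
    have h3 : t * (κ * F y) < t * F (y - h n) := by nlinarith
    exact (lt_of_mul_lt_mul_left h3 ht.le).le
  let B : ℕ → Set ℝ := fun j => {y | y ∈ K ∧ δ * κ ^ j ≤ F y}
  obtain ⟨j, hj, hj'⟩ : ∃ j, volume (B j) ≠ 0 ∧ volume (B (j + 1)) = 0 := by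
    by_contra! hcon
    have hall : ∀ j, volume (B j) ≠ 0 := by
      intro j
      induction j with
      | zero =>
        have : B 0 = K := by
          ext y; simp only [B, mem_ofPred_eq, pow_zero, mul_one, and_iff_left_iff_imp]
          exact fun hy => (hKF y hy).1
        rwa [this]
      | succ j ih => exact hcon j ih
    obtain ⟨J, hJ⟩ := pow_unbounded_of_one_lt (M / δ) hκ1
    rw [div_lt_iff₀ hδ] at hJ
    apply hall J
    have : B J = ∅ := by
      ext y; simp only [B, mem_ofPred_eq, mem_empty_iff_false, iff_false, not_and, not_le]
      intro hy
      have := (hKF y hy).2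
      linarith
    simp [this]
  let Y : ℕ → Set ℝ := fun N => {y | y ∈ B j ∧ ∀ n ≥ N, κ * F y ≤ F (y - h n)}
  have hκ0 : 0 < κ := by linarith
  have hYU : B j ⊆ ⋃ N, Y N := by
    intro y hy
    have hFy : 0 < F y := lt_of_lt_of_le (by positivity) hy.2
    obtain ⟨N, hN⟩ := eventually_atTop.1 (key y hFy)
    exact mem_iUnion.2 ⟨N, hy, hN⟩
  obtain ⟨N, hN⟩ : ∃ N, volume (Y N) ≠ 0 := by
    by_contra! hcon
    exact hj (measure_mono_null hYU (measure_iUnion_null hcon))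
  have hlim : Tendsto (fun n => volume (symmDiff ((fun y => y - h n) ⁻¹' K) K)) atTop (𝓝 0) := by
    have := tendsto_measure_symmDiff_preimage_nhds_zero (μ := (volume : Measure ℝ))
      (ν := (volume : Measure ℝ)) (l := (atTop : Filter ℕ)) (s := K)
      (f := fun n => ⟨fun y => y - h n, by fun_prop⟩) (g := ContinuousMap.id ℝ) ?_ ?_ ?_
      hKm.nullMeasurableSet hKtop
    · simpa using this
    · have hc : Continuous fun a : ℝ => (⟨fun y => y - a, by fun_prop⟩ : C(ℝ, ℝ)) :=
        ContinuousMap.continuous_of_continuous_uncurry _ (by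
          unfold Function.uncurry; simp only [ContinuousMap.coe_mk]; fun_prop)
      have := (hc.tendsto 0).comp hh0
      convert! this using 2
      ext y; simp
    · exact Eventually.of_forall fun n => measurePreserving_sub_right volume (h n)
    · exact MeasurePreserving.id _
  have hle : ∀ n ≥ N, volume (Y N) ≤ volume (symmDiff ((fun y => y - h n) ⁻¹' K) K) := by
    intro n hn
    have hsub : Y N ⊆ ((fun y => y - h n) ⁻¹' B (j + 1)) ∪ (symmDiff ((fun y => y - h n) ⁻¹' K) K) := by
      intro y hy
      by_cases hyK : y - h n ∈ K
      · left
        refine ⟨hyK, ?_⟩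
        have h1 := hy.2 n hn
        have h2 := hy.1.2
        calc δ * κ ^ (j + 1) = κ * (δ * κ ^ j) := by ring
          _ ≤ κ * F y := by gcongr
          _ ≤ _ := h1
      · right
        exact Or.inr ⟨hy.1.1, hyK⟩
    refine (measure_mono hsub).trans ((measure_union_le _ _).trans ?_)
    rw [(measurePreserving_sub_right volume (h n)).quasiMeasurePreserving.preimage_null hj',
      zero_add]
  exact hN (le_antisymm (ge_of_tendsto hlim (eventually_atTop.2 ⟨N, hle⟩)) zero_le)

open Set Filter Topology in
lemma lintegral_fractional_le_liminf (H : Measure ℝ) (l w : ℝ) (u : ℕ → ℝ)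
    (hu : Tendsto u atTop (𝓝 w)) :
    ∫⁻ x in Ioi w, ENNReal.ofReal ((x - w) ^ (l - 1)) ∂H
      ≤ liminf (fun n => ∫⁻ x in Ioi (u n), ENNReal.ofReal ((x - u n) ^ (l - 1)) ∂H) atTop := by
  have hm : ∀ a : ℝ, Measurable fun x : ℝ =>
      (Ioi a).indicator (fun x => ENNReal.ofReal ((x - a) ^ (l - 1))) x := fun a =>
    Measurable.indicator (by fun_prop) measurableSet_Ioi
  simp only [← lintegral_indicator measurableSet_Ioi]
  refine le_trans (lintegral_mono fun x => ?_) (lintegral_liminf_le fun n => hm (u n))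
  by_cases hx : w < x
  · have h1 : Tendsto (fun n => (Ioi (u n)).indicator
        (fun x => ENNReal.ofReal ((x - u n) ^ (l - 1))) x) atTop
        (𝓝 (ENNReal.ofReal ((x - w) ^ (l - 1)))) := by
      have h2 : Tendsto (fun n => ENNReal.ofReal ((x - u n) ^ (l - 1))) atTop
          (𝓝 (ENNReal.ofReal ((x - w) ^ (l - 1)))) := by
        refine ENNReal.tendsto_ofReal ?_
        exact (tendsto_const_nhds.sub hu).rpow_const (Or.inl (by simp; linarith))
      refine h2.congr' ?_
      filter_upwards [hu.eventually (gt_mem_nhds hx)] with n hn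
      simp [indicator, hn]
    rw [h1.liminf_eq]
    simp [indicator, hx]
  · simp [indicator, hx]

open Set Filter Topology in
lemma IsHMDensity.lowerSemicontinuous_mul {l : ℝ} {f : ℝ → ℝ} (hf : IsHMDensity l f) (c : ℝ) :
    LowerSemicontinuous fun x => f (exp x) * f (exp (c - x)) := by
  obtain ⟨H, hH⟩ := hf.2.2 (exp (c / 2)) (exp_pos _)
  let w : ℝ → ℝ := fun x => exp (x - c / 2) + (exp (x - c / 2))⁻¹
  have hw : Continuous w := by
    have : ∀ x, exp (x - c / 2) ≠ 0 := fun x => (exp_pos _).ne'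
    fun_prop (disch := assumption)
  have e : ∀ x, ENNReal.ofReal (f (exp x) * f (exp (c - x)))
      = ∫⁻ y in Ioi (w x), ENNReal.ofReal ((y - w x) ^ (l - 1)) ∂H := by
    intro x
    rw [← hH _ (exp_pos _), ← exp_add, ← exp_sub]
    ring_nf
  intro x t ht
  by_cases ht0 : t < 0
  · exact Eventually.of_forall fun y => ht0.trans_le (mul_nonneg (hf.1 _) (hf.1 _))
  push Not at ht0
  rw [Filter.eventually_iff_seq_eventually]
  intro u hu
  have h1 := lintegral_fractional_le_liminf H l (w x) (w ∘ u) ((hw.tendsto x).comp hu)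
  simp only [Function.comp_apply, ← e] at h1
  have h2 : ENNReal.ofReal t < liminf (fun n => ENNReal.ofReal (f (exp (u n)) * f (exp (c - u n)))) atTop :=
    lt_of_lt_of_le ((ENNReal.ofReal_lt_ofReal_iff (ht0.trans_lt ht)).2 ht) h1
  filter_upwards [eventually_lt_of_lt_liminf h2] with n hn
  exact (ENNReal.ofReal_lt_ofReal_iff_of_nonneg ht0).1 hn

open Set in
lemma IsHMDensity.measurable_comp_exp {l : ℝ} {f : ℝ → ℝ} (hf : IsHMDensity l f) :
    Measurable fun x => f (exp x) := by
  obtain ⟨g, hg, hgf, h_lintegral⟩ := exists_measurable_le_lintegral_eq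
    (μ := volume.restrict (Ioi (0 : ℝ))) (fun x => ENNReal.ofReal (f x))
  rw [hf.2.1] at h_lintegral
  obtain ⟨n, hn⟩ : ∃ n : ℕ,
      (volume.restrict (Ioi (0 : ℝ))) {x | ((n : ENNReal) + 1)⁻¹ < g x} ≠ 0 := by
    by_contra! h
    have h0 : (volume.restrict (Ioi (0 : ℝ))) {x | g x ≠ 0} = 0 := by
      refine measure_mono_null ?_ (measure_iUnion_null h)
      intro x hx
      obtain ⟨n, hn⟩ := ENNReal.exists_inv_nat_lt (a := g x) hx
      exact mem_iUnion.2 ⟨n, lt_of_le_of_lt (by gcongr; exact le_self_add) hn⟩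
    have h1 : g =ᵐ[volume.restrict (Ioi (0 : ℝ))] 0 := by
      rw [Filter.EventuallyEq, ae_iff]; exact h0
    rw [(lintegral_eq_zero_iff hg).2 h1] at h_lintegral
    exact one_ne_zero h_lintegral
  have hms : MeasurableSet {x | ((n : ENNReal) + 1)⁻¹ < g x} := measurableSet_lt measurable_const hg
  refine (lowerSemicontinuous_of_antidiagonal_mul (fun x => f (exp x)) (fun x => hf.1 _)
    hf.lowerSemicontinuous_mul (δ := ((n : ℝ) + 1)⁻¹) (by positivity)
    (E := exp ⁻¹' {x | ((n : ENNReal) + 1)⁻¹ < g x}) (hms.preimage measurable_exp) ?_ ?_).measurable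
  · intro h0
    apply hn
    rw [Measure.restrict_apply hms]
    have : {x | ((n : ENNReal) + 1)⁻¹ < g x} ∩ Ioi 0
        = exp '' (exp ⁻¹' {x | ((n : ENNReal) + 1)⁻¹ < g x}) := by
      rw [image_preimage_eq_inter_range, range_exp]
    rw [this]
    exact addHaar_image_eq_zero_of_differentiableOn_of_addHaar_eq_zero volume
      differentiable_exp.differentiableOn h0
  · intro x hx
    have h1 : ((n : ENNReal) + 1)⁻¹ < ENNReal.ofReal (f (exp x)) := lt_of_lt_of_le hx (hgf _)
    have h2 : ((n : ENNReal) + 1)⁻¹ = ENNReal.ofReal (((n : ℝ) + 1)⁻¹) := by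
      rw [ENNReal.ofReal_inv_of_pos (by positivity), ENNReal.ofReal_add (by positivity) (by simp)]
      simp
    rw [h2] at h1
    exact (ENNReal.ofReal_lt_ofReal_iff_of_nonneg (by positivity)).1 h1 |>.le

open Set in
lemma IsHMDensity.aemeasurable {l : ℝ} {f : ℝ → ℝ} (hf : IsHMDensity l f) :
    Measurable ((Ioi 0).indicator f) := by
  have : (Ioi 0).indicator f = (Ioi 0).indicator (fun x => f (exp (log x))) := by
    ext x
    by_cases hx : 0 < x
    · simp [hx, exp_log hx]
    · simp [hx]
  rw [this]
  exact (hf.measurable_comp_exp.comp measurable_log).indicator measurableSet_Ioi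

open Set in
lemma two_le_add_inv {v : ℝ} (hv : 0 < v) : 2 ≤ v + v⁻¹ := by
  have : 0 ≤ (v - 1) ^ 2 / v := by positivity
  have e : (v - 1) ^ 2 / v = v + v⁻¹ - 2 := by field_simp; ring
  linarith

open Set in
lemma sigmaFinite_of_lintegral_ne_top {α : Type*} [MeasurableSpace α] (μ : Measure α)
    (g : α → ENNReal) (hg : Measurable g) (h0 : ∀ᵐ x ∂μ, g x ≠ 0) (htop : ∀ᵐ x ∂μ, g x ≠ ⊤)
    (h_lintegral : ∫⁻ x, g x ∂μ ≠ ⊤) : SigmaFinite μ := by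
  have : IsFiniteMeasure (μ.withDensity g) := isFiniteMeasure_withDensity h_lintegral
  have e := withDensity_inv_same hg h0 htop
  rw [← e]
  refine SigmaFinite.withDensity_of_ne_top ?_
  have hac : μ.withDensity g ≪ μ := withDensity_absolutelyContinuous _ _
  filter_upwards [hac h0] with x hx using ENNReal.inv_ne_top.2 hx

open Set in
lemma IsHMDensity.exists_sigmaFinite {l : ℝ} {f : ℝ → ℝ} (hf : IsHMDensity l f) {u : ℝ}
    (hu : 0 < u) : ∃ H : Measure ℝ, SigmaFinite H ∧ H (Iic 2) = 0 ∧ ∀ v : ℝ, 0 < v →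
      ENNReal.ofReal (f (u * v) * f (u / v)) =
        ∫⁻ x in Ioi (v + v⁻¹), ENNReal.ofReal ((x - (v + v⁻¹)) ^ (l - 1)) ∂H := by
  obtain ⟨H, hH⟩ := hf.2.2 u hu
  refine ⟨H.restrict (Ioi 2), ?_, ?_, ?_⟩
  · refine sigmaFinite_of_lintegral_ne_top _ (fun x => ENNReal.ofReal ((x - 2) ^ (l - 1)))
      (by fun_prop) ?_ (Filter.Eventually.of_forall fun x => ENNReal.ofReal_ne_top) ?_
    · filter_upwards [ae_restrict_mem measurableSet_Ioi] with x hx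
      have : 0 < x - 2 := sub_pos.2 hx
      simp only [ne_eq, ENNReal.ofReal_eq_zero, not_le]
      positivity
    · have := hH 1 one_pos
      norm_num at this
      rw [← this]
      simp
  · rw [Measure.restrict_apply measurableSet_Iic]
    simp [Iic_inter_Ioi]
  · intro v hv
    rw [hH v hv, Measure.restrict_restrict measurableSet_Ioi, Ioi_inter_Ioi,
      sup_eq_left.2 (two_le_add_inv hv)]

open Set in
lemma lintegral_beta_scaled {a b s t : ℝ} (ha : 0 < a) (hb : 0 < b) (hst : s < t) :
    ∫⁻ x in Ioo s t, ENNReal.ofReal ((x - s) ^ (a - 1) * (t - x) ^ (b - 1))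
      = ENNReal.ofReal (beta a b * (t - s) ^ (a + b - 1)) := by
  have hd : 0 < t - s := sub_pos.2 hst
  have hB : 0 < beta a b := beta_pos ha hb
  have h1 : Ioo s t = (fun y => s + (t - s) * y) '' Ioo 0 1 := by
    ext x
    simp only [mem_Ioo, mem_image]
    constructor
    · rintro ⟨h1, h2⟩
      refine ⟨(x - s) / (t - s), ⟨div_pos (by linarith) hd, (div_lt_one hd).2 (by linarith)⟩, ?_⟩
      field_simp
      ring
    · rintro ⟨y, ⟨h1, h2⟩, rfl⟩
      constructor <;> nlinarith
  rw [h1, lintegral_image_eq_lintegral_abs_deriv_mul measurableSet_Ioo (f' := fun _ => t - s)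
    (fun x _ => by
      simpa using (((hasDerivAt_id x).const_mul (t - s)).const_add s).hasDerivWithinAt)
    (fun x _ y _ hxy => by
      have h : (t - s) * x = (t - s) * y := by simpa using hxy
      exact mul_left_cancel₀ hd.ne' h)]
  have h2 : ∀ y ∈ Ioo (0 : ℝ) 1, ENNReal.ofReal |t - s| *
      ENNReal.ofReal ((s + (t - s) * y - s) ^ (a - 1) * (t - (s + (t - s) * y)) ^ (b - 1))
      = ENNReal.ofReal (beta a b * (t - s) ^ (a + b - 1)) * betaPDF a b y := by
    intro y hy
    have hy' : 0 < 1 - y := by linarith [hy.2]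
    rw [betaPDF_of_pos_lt_one hy.1 hy.2, abs_of_pos hd, ← ENNReal.ofReal_mul hd.le,
      ← ENNReal.ofReal_mul (by positivity)]
    congr 1
    rw [show s + (t - s) * y - s = (t - s) * y by ring,
      show t - (s + (t - s) * y) = (t - s) * (1 - y) by ring, mul_rpow hd.le hy.1.le,
      mul_rpow hd.le hy'.le, show a + b - 1 = 1 + (a - 1) + (b - 1) by ring, rpow_add hd,
      rpow_add hd, rpow_one]
    field_simp
  rw [setLIntegral_congr_fun measurableSet_Ioo h2, lintegral_const_mul _ (by
    unfold betaPDF; exact (measurable_betaPDFReal a b).ennreal_ofReal)]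
  have h3 : ∫⁻ y in Ioo 0 1, betaPDF a b y = 1 := by
    rw [← lintegral_betaPDF_eq_one ha hb, lintegral_betaPDF]
    exact setLIntegral_congr_fun measurableSet_Ioo fun y hy => betaPDF_of_pos_lt_one hy.1 hy.2
  rw [h3, mul_one]

open Set in
lemma IsHMDensity.mono {k l : ℝ} (hk : 0 < k) (hkl : k ≤ l) {f : ℝ → ℝ} (hf : IsHMDensity l f) :
    IsHMDensity k f := by
  rcases hkl.eq_or_lt with rfl | hkl
  · exact hf
  refine ⟨hf.1, hf.2.1, fun u hu => ?_⟩
  obtain ⟨H, hHs, -, hH⟩ := hf.exists_sigmaFinite hu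
  have hB : 0 < beta k (l - k) := beta_pos hk (sub_pos.2 hkl)
  have hmD : Measurable fun p : ℝ × ℝ => (Ioi p.1).indicator
      (fun y => ENNReal.ofReal ((beta k (l - k))⁻¹ * (y - p.1) ^ (l - k - 1))) p.2 := by
    have : (fun p : ℝ × ℝ => (Ioi p.1).indicator
      (fun y => ENNReal.ofReal ((beta k (l - k))⁻¹ * (y - p.1) ^ (l - k - 1))) p.2)
      = {p : ℝ × ℝ | p.1 < p.2}.indicator
        fun p => ENNReal.ofReal ((beta k (l - k))⁻¹ * (p.2 - p.1) ^ (l - k - 1)) := by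
      ext p; simp [indicator]
    rw [this]
    exact Measurable.indicator (by fun_prop) (measurableSet_lt measurable_fst measurable_snd)
  refine ⟨volume.withDensity fun x => ∫⁻ y, (Ioi x).indicator
    (fun y => ENNReal.ofReal ((beta k (l - k))⁻¹ * (y - x) ^ (l - k - 1))) y ∂H, fun v hv => ?_⟩
  rw [hH v hv]
  set w := v + v⁻¹
  rw [setLIntegral_withDensity_eq_setLIntegral_mul _ hmD.lintegral_prod_right' (by fun_prop)
    measurableSet_Ioi]
  simp only [Pi.mul_apply]
  have h1 : ∀ x, (∫⁻ y, (Ioi x).indicator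
      (fun y => ENNReal.ofReal ((beta k (l - k))⁻¹ * (y - x) ^ (l - k - 1))) y ∂H) *
      ENNReal.ofReal ((x - w) ^ (k - 1)) = ∫⁻ y, (Ioi x).indicator
      (fun y => ENNReal.ofReal ((beta k (l - k))⁻¹ * (y - x) ^ (l - k - 1))) y
        * ENNReal.ofReal ((x - w) ^ (k - 1)) ∂H := fun x => by
    have hm : Measurable fun y => (Ioi x).indicator
        (fun y => ENNReal.ofReal ((beta k (l - k))⁻¹ * (y - x) ^ (l - k - 1))) y :=
      hmD.comp (measurable_const.prodMk measurable_id)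
    rw [lintegral_mul_const _ hm]
  simp only [h1]
  rw [lintegral_lintegral_swap (Measurable.aemeasurable (hmD.mul (by fun_prop))),
    ← lintegral_indicator measurableSet_Ioi]
  refine lintegral_congr fun y => ?_
  by_cases hy : w < y
  · have h2 : ∀ x, (Ioi w).indicator (fun x => (Ioi x).indicator
        (fun y => ENNReal.ofReal ((beta k (l - k))⁻¹ * (y - x) ^ (l - k - 1))) y *
        ENNReal.ofReal ((x - w) ^ (k - 1))) x = ENNReal.ofReal (beta k (l - k))⁻¹ *
        (Ioo w y).indicator
        (fun x => ENNReal.ofReal ((x - w) ^ (k - 1) * (y - x) ^ (l - k - 1))) x := by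
      intro x
      by_cases h1 : w < x <;> by_cases h2 : x < y <;> simp [h1, h2, indicator]
      have h1' : 0 ≤ x - w := by linarith
      have h2' : 0 ≤ y - x := by linarith
      rw [← ENNReal.ofReal_mul (by positivity), ← ENNReal.ofReal_mul (by positivity)]
      ring_nf
    rw [← lintegral_indicator measurableSet_Ioi]
    simp only [h2]
    rw [lintegral_const_mul _ (Measurable.indicator (by fun_prop) measurableSet_Ioo),
      lintegral_indicator measurableSet_Ioo, lintegral_beta_scaled hk (sub_pos.2 hkl) hy,
      ← ENNReal.ofReal_mul (by positivity), inv_mul_cancel_left₀ hB.ne']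
    simp [hy]
  · rw [indicator_of_notMem (by simpa using hy), setLIntegral_eq_zero measurableSet_Ioi]
    intro x hx
    have : ¬ x < y := fun h => hy (lt_trans hx h)
    simp [this]

open Set in
lemma lintegral_moebius_substitution {k α v t₁ t₂ : ℝ} (hα : 0 < α) (hv : 0 < v)
    (h1 : 0 < t₁) (h12 : t₁ < t₂) (hprod : t₁ * t₂ = 1) :
    ∫⁻ t in Ioo t₁ t₂, ENNReal.ofReal (t⁻¹ * (t₁ + t₂ - (t + t⁻¹)) ^ (k - 1) *
        ((t + α * v) * (t + v / α) / (t * v)) ^ (-k))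
      = ENNReal.ofReal ((t₂ - t₁) ^ (2 * k - 1)) * ∫⁻ p in Ioo 0 1,
        ENNReal.ofReal ((p * (1 - p)) ^ (k - 1) *
          (v + v⁻¹ + (p * (t₁ / α + α * t₂) + (1 - p) * (α * t₁ + t₂ / α))) ^ (-k)) := by
  have hβ : 0 < α * v := by positivity
  have h2 : 0 < t₂ := h1.trans h12
  have hD : 0 < t₂ - t₁ := sub_pos.2 h12
  let φ : ℝ → ℝ := fun t => (t₂ + α * v) * (t - t₁) / ((t₂ - t₁) * (t + α * v))
  have himg : Ioo 0 1 = φ '' Ioo t₁ t₂ := by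
    ext p
    simp only [mem_Ioo, mem_image, φ]
    constructor
    · rintro ⟨hp0, hp1⟩
      have hden : 0 < t₂ + α * v - p * (t₂ - t₁) := by nlinarith
      refine ⟨(p * (t₂ - t₁) * (α * v) + (t₂ + α * v) * t₁) / (t₂ + α * v - p * (t₂ - t₁)),
        ⟨?_, ?_⟩, ?_⟩
      · rw [lt_div_iff₀ hden]
        have : 0 < p * (t₂ - t₁) * (α * v + t₁) := by positivity
        nlinarith
      · rw [div_lt_iff₀ hden]
        have : 0 < (1 - p) * ((t₂ - t₁) * (α * v + t₂)) := mul_pos (by linarith) (by positivity)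
        nlinarith
      · have e1 : (p * (t₂ - t₁) * (α * v) + (t₂ + α * v) * t₁) / (t₂ + α * v - p * (t₂ - t₁)) - t₁
            = p * (t₂ - t₁) * (α * v + t₁) / (t₂ + α * v - p * (t₂ - t₁)) := by
          rw [eq_div_iff hden.ne', sub_mul, div_mul_cancel₀ _ hden.ne']; ring
        have e2 : (p * (t₂ - t₁) * (α * v) + (t₂ + α * v) * t₁) / (t₂ + α * v - p * (t₂ - t₁))
            + α * v = (t₂ + α * v) * (α * v + t₁) / (t₂ + α * v - p * (t₂ - t₁)) := by
          rw [eq_div_iff hden.ne', add_mul, div_mul_cancel₀ _ hden.ne']; ring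
        rw [e1, e2]
        field_simp
    · rintro ⟨t, ⟨ht1, ht2⟩, rfl⟩
      have htβ : 0 < t + α * v := by linarith
      have : 0 < t - t₁ := by linarith
      refine ⟨by positivity, ?_⟩
      rw [div_lt_one (by positivity)]
      have : 0 < (t₂ - t) * (α * v + t₁) := mul_pos (by linarith) (by positivity)
      nlinarith
  have hderiv : ∀ t ∈ Ioo t₁ t₂, HasDerivWithinAt φ
      ((t₁ + α * v) * (t₂ + α * v) / ((t₂ - t₁) * (t + α * v) ^ 2)) (Ioo t₁ t₂) t := by
    rintro t ⟨ht1, ht2⟩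
    have htβ : 0 < t + α * v := by linarith
    refine HasDerivAt.hasDerivWithinAt ?_
    have := (((hasDerivAt_id t).sub_const t₁).const_mul (t₂ + α * v)).div
      (((hasDerivAt_id t).add_const (α * v)).const_mul (t₂ - t₁)) (by simp; constructor <;> positivity)
    refine this.congr_deriv ?_
    simp only [id]
    field_simp
    ring
  have hinj : InjOn φ (Ioo t₁ t₂) := by
    rintro t ⟨ht1, ht2⟩ s ⟨hs1, hs2⟩ hts
    have htβ : 0 < t + α * v := by linarith
    have hsβ : 0 < s + α * v := by linarith
    simp only [φ] at hts
    rw [div_eq_div_iff (by positivity) (by positivity)] at hts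
    have : (t₂ + α * v) * (t₂ - t₁) * (α * v + t₁) * (t - s) = 0 := by linear_combination hts
    have hne : (t₂ + α * v) * (t₂ - t₁) * (α * v + t₁) ≠ 0 := by positivity
    have := (mul_eq_zero.1 this).resolve_left hne
    linarith
  rw [himg, lintegral_image_eq_lintegral_abs_deriv_mul measurableSet_Ioo hderiv hinj,
    ← lintegral_const_mul' _ _ ENNReal.ofReal_ne_top]
  refine setLIntegral_congr_fun measurableSet_Ioo ?_
  rintro t ⟨ht1, ht2⟩
  have ht : 0 < t := h1.trans ht1
  have htβ : 0 < t + α * v := by linarith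
  have htγ : 0 < t + v / α := by positivity
  have ha : 0 < t - t₁ := by linarith
  have hb : 0 < t₂ - t := by linarith
  have e0 : t₁ + t₂ - (t + t⁻¹) = (t - t₁) * (t₂ - t) / t := by
    field_simp; linear_combination hprod
  set m := (t₁ + α * v) * (t₂ + α * v) / (t + α * v) ^ 2 with hm
  set L := (t - t₁) * (t₂ - t) / t with hL
  set R := (t + α * v) * (t + v / α) / (t * v) with hR
  have hm0 : 0 < m := by positivity
  have hL0 : 0 < L := by positivity
  have hR0 : 0 < R := by positivity
  have e1 : (t₁ + α * v) * (t₂ + α * v) / ((t₂ - t₁) * (t + α * v) ^ 2) = m / (t₂ - t₁) := by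
    rw [hm]; field_simp
  have e2' : 1 - φ t = (t₁ + α * v) * (t₂ - t) / ((t₂ - t₁) * (t + α * v)) := by
    simp only [φ]; field_simp; ring
  have e2 : φ t * (1 - φ t) = m * L * t / ((t₂ - t₁) ^ 2) := by
    rw [e2']; simp only [φ, hm, hL]; field_simp
  have e3 : v + v⁻¹ + (φ t * (t₁ / α + α * t₂) + (1 - φ t) * (α * t₁ + t₂ / α)) = m * R * t := by
    have f1 : v + v⁻¹ + (t₁ / α + α * t₂) = (t₁ + α * v) * (t₂ + v / α) / v := by
      field_simp; linear_combination (-α) * hprod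
    have f2 : v + v⁻¹ + (α * t₁ + t₂ / α) = (t₂ + α * v) * (t₁ + v / α) / v := by
      field_simp; linear_combination (-α) * hprod
    have f3 : v + v⁻¹ + (φ t * (t₁ / α + α * t₂) + (1 - φ t) * (α * t₁ + t₂ / α))
        = φ t * (v + v⁻¹ + (t₁ / α + α * t₂)) + (1 - φ t) * (v + v⁻¹ + (α * t₁ + t₂ / α)) := by
      ring
    rw [f3, f1, f2, e2']; simp only [φ, hm, hR]; field_simp; ring
  simp only []
  rw [e0, e1, e2, e3, abs_of_pos (by positivity), ← ENNReal.ofReal_mul (by positivity),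
    ← ENNReal.ofReal_mul (by positivity)]
  congr 1
  rw [← hR]
  clear_value m L R
  rw [div_rpow (by positivity) (by positivity), mul_rpow (by positivity) ht.le,
    mul_rpow hm0.le hL0.le, mul_rpow (by positivity) ht.le, mul_rpow hm0.le hR0.le,
    ← rpow_natCast (t₂ - t₁), ← rpow_mul hD.le, rpow_sub_one hm0.ne', rpow_sub_one ht.ne',
    show ((2 : ℕ) : ℝ) * (k - 1) = (2 * k - 1) - 1 by push_cast; ring, rpow_sub_one hD.ne' (2 * k - 1),
    rpow_neg hm0.le, rpow_neg ht.le]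
  have := (rpow_pos_of_pos hm0 k).ne'
  have := (rpow_pos_of_pos ht k).ne'
  have := (rpow_pos_of_pos hD (2 * k - 1)).ne'
  field_simp

open Set in
lemma mem_Ioo_add_inv_roots {x t : ℝ} (hx : 2 < x) (ht : 0 < t) :
    t + t⁻¹ < x ↔ t ∈ Ioo ((x - √(x ^ 2 - 4)) / 2) ((x + √(x ^ 2 - 4)) / 2) := by
  have h0 : 0 ≤ x ^ 2 - 4 := by nlinarith
  have hD := Real.sq_sqrt h0
  set D := √(x ^ 2 - 4)
  have hD0 : 0 ≤ D := Real.sqrt_nonneg _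
  have e : t + t⁻¹ < x ↔ (2 * t - x) ^ 2 < D ^ 2 := by
    rw [hD, ← sub_pos, show x - (t + t⁻¹) = (x * t - (t ^ 2 + 1)) / t by field_simp,
      div_pos_iff_of_pos_right ht]
    constructor <;> intro h <;> nlinarith
  rw [e, sq_lt_sq, abs_of_nonneg hD0, abs_lt, mem_Ioo]
  constructor <;> rintro ⟨h1, h2⟩ <;> constructor <;> linarith

open Set in
lemma IsHMDensity.exists_mixture {k : ℝ} {f : ℝ → ℝ} (hf : IsHMDensity k f) {r u : ℝ}
    (hr : 0 < r) (hu : 0 < u) : ∃ ν : Measure ℝ, ν (Iio 0) = 0 ∧ ∀ v : ℝ, 0 < v →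
      ∫⁻ t in Ioi 0, ENNReal.ofReal (t⁻¹ * (f (r * t) * f (r / t)) *
          ((r * t + u * v) * (r / t + u / v)) ^ (-k))
        = ∫⁻ b, ENNReal.ofReal ((b + (v + v⁻¹ + 2)) ^ (-k)) ∂ν := by
  obtain ⟨H, hHs, hH2, hH⟩ := hf.exists_sigmaFinite hr
  set α := u / r with hα
  have hα0 : 0 < α := by positivity
  have hHae : ∀ᵐ x ∂H, 2 < x := by
    rw [ae_iff]; simpa [Iic_def] using hH2
  let D : ℝ → ℝ := fun x => √(x ^ 2 - 4)
  let t₁ : ℝ → ℝ := fun x => (x - D x) / 2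
  let t₂ : ℝ → ℝ := fun x => (x + D x) / 2
  have hroots : ∀ x, 2 < x → 0 < t₁ x ∧ t₁ x < t₂ x ∧ t₁ x * t₂ x = 1 ∧ t₁ x + t₂ x = x ∧
      t₂ x - t₁ x = D x := by
    intro x hx
    have h0 : 0 < x ^ 2 - 4 := by nlinarith
    have hD2 : D x ^ 2 = x ^ 2 - 4 := Real.sq_sqrt h0.le
    have hD0 : 0 < D x := Real.sqrt_pos.2 h0
    have : D x < x := by
      apply lt_of_pow_lt_pow_left₀ 2 (by linarith); linarith
    simp only [t₁, t₂]
    refine ⟨by linarith, by linarith, by linarith, by ring, by ring⟩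
  let B : ℝ × ℝ → ℝ := fun z =>
    z.2 * (t₁ z.1 / α + α * t₂ z.1) + (1 - z.2) * (α * t₁ z.1 + t₂ z.1 / α) - 2
  let b : ℝ × ℝ → ℝ := fun z => max (B z) 0
  have hB : ∀ x p, 2 < x → p ∈ Ioo (0:ℝ) 1 → 0 ≤ B (x, p) := by
    rintro x p hx ⟨hp0, hp1⟩
    obtain ⟨h1, h2, h3, -, -⟩ := hroots x hx
    have h4 : t₂ x = (t₁ x)⁻¹ := eq_inv_of_mul_eq_one_right h3
    have g1 := two_le_add_inv (v := t₁ x / α) (by positivity)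
    have g2 := two_le_add_inv (v := t₁ x * α) (by positivity)
    have g3 : t₁ x / α + α * t₂ x = t₁ x / α + (t₁ x / α)⁻¹ := by rw [h4, inv_div (t₁ x) α, div_eq_mul_inv α (t₁ x)]
    have g4 : α * t₁ x + t₂ x / α = t₁ x * α + (t₁ x * α)⁻¹ := by rw [h4, mul_inv, div_eq_mul_inv, mul_comm α]
    simp only [B]
    rw [g3, g4]
    nlinarith
  have hDm : Measurable D := by fun_prop
  have hBm : Measurable B := by fun_prop
  have hbm : Measurable b := hBm.max measurable_const
  let w : ℝ × ℝ → ENNReal := fun z => ENNReal.ofReal ((r * u) ^ (-k) * D z.1 ^ (2 * k - 1)) *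
    ENNReal.ofReal ((z.2 * (1 - z.2)) ^ (k - 1))
  have hwm : Measurable w := by fun_prop
  refine ⟨((H.prod (volume.restrict (Ioo 0 1))).withDensity w).map b, ?_, ?_⟩
  · rw [Measure.map_apply hbm measurableSet_Iio]
    have : b ⁻¹' Iio 0 = ∅ := by ext z; simp [b]
    rw [this, measure_empty]
  intro v hv
  rw [lintegral_map (by fun_prop) hbm, lintegral_withDensity_eq_lintegral_mul _ hwm (by fun_prop),
    lintegral_prod _ (by fun_prop)]
  have hS : MeasurableSet {z : ℝ × ℝ | z.1 + z.1⁻¹ < z.2} :=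
    measurableSet_lt (by fun_prop) (by fun_prop)
  let K : ℝ × ℝ → ENNReal := {z : ℝ × ℝ | z.1 + z.1⁻¹ < z.2}.indicator fun z =>
    ENNReal.ofReal ((r * u) ^ (-k)) * ENNReal.ofReal (z.1⁻¹ * (z.2 - (z.1 + z.1⁻¹)) ^ (k - 1) *
      ((z.1 + α * v) * (z.1 + v / α) / (z.1 * v)) ^ (-k))
  have hK : Measurable K := Measurable.indicator (by fun_prop) hS
  have e1 : ∀ t ∈ Ioi (0:ℝ), ENNReal.ofReal (t⁻¹ * (f (r * t) * f (r / t)) *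
          ((r * t + u * v) * (r / t + u / v)) ^ (-k)) = ∫⁻ x, K (t, x) ∂H := by
    intro t ht
    have ht : 0 < t := ht
    have q : ((r * t + u * v) * (r / t + u / v)) ^ (-k) =
        (r * u) ^ (-k) * ((t + α * v) * (t + v / α) / (t * v)) ^ (-k) := by
      rw [← mul_rpow (by positivity) (by positivity)]
      congr 1
      rw [hα]; field_simp; ring
    rw [show t⁻¹ * (f (r * t) * f (r / t)) * ((r * t + u * v) * (r / t + u / v)) ^ (-k)
      = (t⁻¹ * ((r * t + u * v) * (r / t + u / v)) ^ (-k)) * (f (r * t) * f (r / t)) by ring,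
      ENNReal.ofReal_mul (by positivity), hH t ht, ← lintegral_const_mul' _ _ ENNReal.ofReal_ne_top,
      ← lintegral_indicator measurableSet_Ioi]
    refine lintegral_congr fun x => ?_
    by_cases hx : t + t⁻¹ < x
    · rw [indicator_of_mem (by exact hx), show K (t, x) = _ from indicator_of_mem (by exact hx) _]
      simp only
      have : 0 < x - (t + t⁻¹) := by linarith
      rw [← ENNReal.ofReal_mul (by positivity), ← ENNReal.ofReal_mul (by positivity), q]
      congr 1
      ring
    · rw [indicator_of_notMem (by exact hx), show K (t, x) = _ from indicator_of_notMem (by exact hx) _]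
  rw [setLIntegral_congr_fun measurableSet_Ioi e1,
    lintegral_lintegral_swap (f := fun t x => K (t, x)) (by exact hK.aemeasurable)]
  refine lintegral_congr_ae ?_
  filter_upwards [hHae] with x hx
  obtain ⟨h1, h2, h3, h4, h5⟩ := hroots x hx
  have hD0 : 0 < D x := by linarith
  have e2 : ∀ t ∈ Ioi (0:ℝ), K (t, x) = (Ioo (t₁ x) (t₂ x)).indicator (fun t =>
      ENNReal.ofReal ((r * u) ^ (-k)) * ENNReal.ofReal (t⁻¹ * (t₁ x + t₂ x - (t + t⁻¹)) ^ (k - 1) *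
      ((t + α * v) * (t + v / α) / (t * v)) ^ (-k))) t := by
    intro t ht
    by_cases hx' : t + t⁻¹ < x
    · rw [indicator_of_mem ((mem_Ioo_add_inv_roots hx ht).1 hx'), show K (t, x) = _ from indicator_of_mem (by exact hx') _, h4]
    · rw [indicator_of_notMem (fun h => hx' ((mem_Ioo_add_inv_roots hx ht).2 h)), show K (t, x) = _ from indicator_of_notMem (by exact hx') _]
  rw [setLIntegral_congr_fun measurableSet_Ioi e2, lintegral_indicator measurableSet_Ioo,
    Measure.restrict_restrict measurableSet_Ioo, inter_eq_left.2 (show Ioo (t₁ x) (t₂ x) ⊆ Ioi 0 from fun y hy => h1.trans hy.1),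
    lintegral_const_mul' _ _ ENNReal.ofReal_ne_top, lintegral_moebius_substitution hα0 hv h1 h2 h3,
    h5, ← mul_assoc, ← ENNReal.ofReal_mul (by positivity),
    ← lintegral_const_mul' _ _ ENNReal.ofReal_ne_top]
  refine setLIntegral_congr_fun measurableSet_Ioo ?_
  intro p hp
  have hB' := hB x p hx hp
  have : 0 < p * (1 - p) := mul_pos hp.1 (by linarith [hp.2])
  simp only [w, Pi.mul_apply, b, max_eq_left hB', mul_assoc]
  rw [ENNReal.ofReal_mul (p := (p * (1 - p)) ^ (k - 1)) (by positivity)]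
  congr 3
  simp only [B]
  ring_nf

open Set Filter Topology in
lemma differentiableOn_integral_of_dominated {α : Type*} [MeasurableSpace α] {μ : Measure α}
    {U : Set ℂ} (hU : IsOpen U) {F : ℂ → α → ℂ}
    (hmeas : ∀ z ∈ U, AEStronglyMeasurable (F z) μ)
    (hdiff : ∀ᵐ a ∂μ, DifferentiableOn ℂ (fun z => F z a) U)
    (hbound : ∀ z₀ ∈ U, ∃ ε > 0, ∃ g : α → ℝ, Integrable g μ ∧
      ∀ᵐ a ∂μ, ∀ z ∈ Metric.ball z₀ ε, ‖F z a‖ ≤ g a) :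
    DifferentiableOn ℂ (fun z => ∫ a, F z a ∂μ) U := by
  intro z₀ hz₀
  obtain ⟨ε, hε, g, hg, hFg⟩ := hbound z₀ hz₀
  obtain ⟨ε', hε', hball⟩ := Metric.isOpen_iff.1 hU z₀ hz₀
  set δ := min ε ε' / 2 with hδ
  have hδ0 : 0 < δ := by positivity
  have hsub : ∀ z ∈ Metric.ball z₀ δ, Metric.closedBall z (δ / 2) ⊆ Metric.ball z₀ ε ∩ U := by
    intro z hz w hw
    have h1 : dist w z₀ < 2 * δ := by
      have := dist_triangle w z z₀
      rw [Metric.mem_ball] at hz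
      rw [Metric.mem_closedBall] at hw
      linarith
    have h2 : 2 * δ = min ε ε' := by rw [hδ]; ring
    rw [h2] at h1
    exact ⟨h1.trans_le (min_le_left _ _), hball (h1.trans_le (min_le_right _ _))⟩
  have hsub' : ∀ z ∈ Metric.ball z₀ δ, z ∈ Metric.ball z₀ ε ∩ U := fun z hz =>
    hsub z hz (Metric.mem_closedBall_self (by positivity))
  have hd : ∀ᵐ a ∂μ, ∀ z ∈ Metric.ball z₀ δ,
      HasDerivAt (fun z => F z a) (deriv (fun z => F z a) z) z := by
    filter_upwards [hdiff] with a ha z hz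
    exact ((ha z (hsub' z hz).2).differentiableAt (hU.mem_nhds (hsub' z hz).2)).hasDerivAt
  have hz₀δ : z₀ ∈ Metric.ball z₀ δ := Metric.mem_ball_self hδ0
  have hFm : ∀ z ∈ Metric.ball z₀ δ, AEStronglyMeasurable (F z) μ := fun z hz =>
    hmeas z (hsub' z hz).2
  have key := hasDerivAt_integral_of_dominated_loc_of_deriv_le (μ := μ) (F := F)
    (F' := fun z a => deriv (fun z => F z a) z) (x₀ := z₀) (bound := fun a => g a / (δ / 2))
    (Metric.ball_mem_nhds z₀ hδ0)
    (by filter_upwards [Metric.ball_mem_nhds z₀ hδ0] with z hz using hFm z hz)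
    (hg.mono' (hmeas z₀ hz₀) (by
      filter_upwards [hFg] with a ha using ha z₀ (Metric.mem_ball_self hε))) ?_ ?_
    (hg.div_const _) hd
  · exact key.2.differentiableAt.differentiableWithinAt
  · obtain ⟨u, hu, hu0⟩ : ∃ u : ℕ → ℂ, (∀ n, u n ∈ Metric.ball z₀ δ ∧ u n ≠ z₀) ∧
        Tendsto u atTop (𝓝 z₀) := by
      refine ⟨fun n => z₀ + ((δ / (n + 2) : ℝ) : ℂ), fun n => ⟨?_, ?_⟩, ?_⟩
      · rw [Metric.mem_ball, dist_self_add_left, Complex.norm_real, Real.norm_eq_abs,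
          abs_of_pos (by positivity), div_lt_iff₀ (by positivity)]
        nlinarith [(Nat.cast_nonneg n : (0:ℝ) ≤ n)]
      · have : (δ / ((n:ℝ) + 2)) ≠ 0 := by positivity
        exact fun h => this (Complex.ofReal_eq_zero.1 (add_eq_left.1 h))
      · have h1 : Tendsto (fun n : ℕ => δ / ((n:ℝ) + 2)) atTop (𝓝 0) :=
          tendsto_const_nhds.div_atTop
            (tendsto_atTop_add_const_right _ _ tendsto_natCast_atTop_atTop)
        have h2 := (Complex.continuous_ofReal.tendsto 0).comp h1
        simpa using! h2.const_add z₀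
    refine aestronglyMeasurable_of_tendsto_ae (f := fun n a => slope (fun z => F z a) z₀ (u n))
      atTop (fun n => ?_) ?_
    · simp only [slope_def_field]
      simp only [div_eq_mul_inv]
      exact ((hFm _ (hu n).1).sub (hFm _ hz₀δ)).mul_const _
    · filter_upwards [hd] with a ha
      exact (hasDerivAt_iff_tendsto_slope.1 (ha z₀ hz₀δ)).comp
        (tendsto_nhdsWithin_iff.2 ⟨hu0, Eventually.of_forall fun n => (hu n).2⟩)
  · filter_upwards [hFg, hdiff] with a ha hda z hz
    refine Complex.norm_deriv_le_of_forall_mem_sphere_norm_le (by positivity) ?_ ?_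
    · refine (hda.mono ?_).diffContOnCl
      rw [closure_ball _ (by positivity)]
      exact fun w hw => (hsub z hz hw).2
    · exact fun w hw => ha w (hsub z hz (Metric.sphere_subset_closedBall hw)).1

open Set Filter Topology in
lemma exists_ball_le_norm_ofReal_add {s₀ : ℂ} (hs₀ : s₀ ∈ Complex.slitPlane) :
    ∃ ε > 0, ∃ δ > 0, ∀ s ∈ Metric.ball s₀ ε, ∀ x : ℝ, 0 ≤ x → δ * (x + 1) ≤ ‖(x : ℂ) + s‖ := by
  obtain ⟨ε, hε, hball⟩ := Metric.isOpen_iff.1 Complex.isOpen_slitPlane s₀ hs₀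
  have hM : 0 < 1 + (‖s₀‖ + ε / 2 + 1) / (ε / 2) := by positivity
  refine ⟨ε / 2, by positivity, (1 + (‖s₀‖ + ε / 2 + 1) / (ε / 2))⁻¹, by positivity, ?_⟩
  intro s hs x hx
  rw [Metric.mem_ball] at hs
  rw [inv_mul_le_iff₀ hM]
  have h1 : ε / 2 ≤ ‖(x : ℂ) + s‖ := by
    by_contra! h
    have : (-x : ℂ) ∈ Metric.ball s₀ ε := by
      rw [Metric.mem_ball]
      have h2 : dist (-x : ℂ) s = ‖(x : ℂ) + s‖ := by
        rw [dist_eq_norm, ← norm_neg]; congr 1; ring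
      have := dist_triangle (-x : ℂ) s s₀
      linarith
    have := hball this
    rw [← Complex.ofReal_neg, Complex.ofReal_mem_slitPlane] at this
    linarith
  have h2 : x ≤ ‖(x : ℂ) + s‖ + ‖s‖ := by
    have := norm_sub_norm_le (x : ℂ) (-s)
    rw [sub_neg_eq_add, norm_neg, Complex.norm_real, Real.norm_eq_abs, abs_of_nonneg hx] at this
    linarith
  have h3 : ‖s‖ ≤ ‖s₀‖ + ε / 2 := by
    have := norm_sub_norm_le s s₀
    rw [dist_eq_norm] at hs
    linarith
  have h4 : ‖s₀‖ + ε / 2 + 1 ≤ (‖s₀‖ + ε / 2 + 1) / (ε / 2) * ‖(x : ℂ) + s‖ := by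
    rw [div_mul_eq_mul_div, le_div_iff₀ (by positivity)]
    gcongr
  linarith

open Set Filter Topology in
lemma exists_ball_norm_cpow_neg_le {k : ℝ} (hk : 0 < k) {s₀ : ℂ} (hs₀ : s₀ ∈ Complex.slitPlane) :
    ∃ ε > 0, ∃ C > 0, ∀ s ∈ Metric.ball s₀ ε, ∀ x : ℝ, 0 ≤ x →
      ‖((x : ℂ) + s) ^ (-k : ℂ)‖ ≤ C * (x + 1) ^ (-k) := by
  obtain ⟨ε, hε, δ, hδ, h⟩ := exists_ball_le_norm_ofReal_add hs₀
  refine ⟨ε, hε, δ ^ (-k), by positivity, fun s hs x hx => ?_⟩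
  rw [← mul_rpow hδ.le (by positivity), ← Complex.ofReal_neg, Complex.norm_cpow_real]
  exact rpow_le_rpow_of_nonpos (by positivity) (h s hs x hx) (by linarith)

lemma ofReal_add_mem_slitPlane {x : ℝ} (hx : 0 ≤ x) {s : ℂ} (hs : s ∈ Complex.slitPlane) :
    (x : ℂ) + s ∈ Complex.slitPlane := by
  rw [Complex.mem_slitPlane_iff] at hs ⊢
  simp only [Complex.add_re, Complex.ofReal_re, Complex.add_im, Complex.ofReal_im, zero_add]
  rcases hs with h | h
  · left; linarith
  · right; exact h

lemma differentiableOn_ofReal_add_cpow {x : ℝ} (hx : 0 ≤ x) (a : ℂ) :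
    DifferentiableOn ℂ (fun s => ((x : ℂ) + s) ^ a) Complex.slitPlane := fun s hs =>
  (((hasDerivAt_id s).const_add (x : ℂ)).cpow_const
    (ofReal_add_mem_slitPlane hx hs)).differentiableAt.differentiableWithinAt

/-- Generalized Stieltjes transforms are holomorphic on the slit plane. -/
lemma differentiableOn_integral_cpow_neg {k : ℝ} (hk : 0 < k) {ν : Measure ℝ}
    (h0 : ∀ᵐ x ∂ν, 0 ≤ x) (h_integrable : Integrable (fun x : ℝ => (x + 1) ^ (-k)) ν) :
    DifferentiableOn ℂ (fun s => ∫ x, ((x : ℂ) + s) ^ (-k : ℂ) ∂ν) Complex.slitPlane := by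
  refine differentiableOn_integral_of_dominated Complex.isOpen_slitPlane ?_ ?_ ?_
  · intro z _
    exact Measurable.aestronglyMeasurable (by fun_prop)
  · filter_upwards [h0] with x hx using differentiableOn_ofReal_add_cpow hx _
  · intro s₀ hs₀
    obtain ⟨ε, hε, C, hC, h⟩ := exists_ball_norm_cpow_neg_le hk hs₀
    refine ⟨ε, hε, _, h_integrable.const_mul C, ?_⟩
    filter_upwards [h0] with x hx s hs using h s hs x hx

lemma integrable_cpow_neg {k : ℝ} (hk : 0 < k) {ν : Measure ℝ}
    (h0 : ∀ᵐ x ∂ν, 0 ≤ x) (h_integrable : Integrable (fun x : ℝ => (x + 1) ^ (-k)) ν) {s : ℂ}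
    (hs : s ∈ Complex.slitPlane) : Integrable (fun x : ℝ => ((x : ℂ) + s) ^ (-k : ℂ)) ν := by
  obtain ⟨ε, hε, C, hC, h⟩ := exists_ball_norm_cpow_neg_le hk hs
  refine (h_integrable.const_mul C).mono' (Measurable.aestronglyMeasurable (by fun_prop)) ?_
  filter_upwards [h0] with x hx using h s (Metric.mem_ball_self hε) x hx

lemma add_inv_add_two_mem_slitPlane {v : ℂ} (hv : v ∈ Complex.slitPlane) :
    v + v⁻¹ + 2 ∈ Complex.slitPlane := by
  have hv0 := Complex.slitPlane_ne_zero hv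
  have hn : 0 < Complex.normSq v := Complex.normSq_pos.2 hv0
  rw [Complex.mem_slitPlane_iff] at hv ⊢
  by_contra! h
  obtain ⟨h1, h2⟩ := h
  simp only [Complex.add_re, Complex.add_im, Complex.inv_re, Complex.inv_im, Complex.re_ofNat,
    Complex.im_ofNat, add_zero] at h1 h2
  have h3 : v.im * (Complex.normSq v - 1) = 0 := by
    field_simp at h2; linarith
  rcases mul_eq_zero.1 h3 with h | h
  · have : 0 < v.re := hv.resolve_right (fun h' => h' h)
    have : 0 < v.re / Complex.normSq v := by positivity
    linarith
  · have hn1 : Complex.normSq v = 1 := by linarith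
    rw [hn1, div_one] at h1
    rw [Complex.normSq_apply] at hn1
    have him : v.im = 0 := by
      have : 1 ≤ v.re * v.re := by nlinarith
      nlinarith [mul_self_nonneg v.im]
    have : 0 < v.re := hv.resolve_right (fun h' => h' him)
    linarith

lemma inv_mem_slitPlane {v : ℂ} (hv : v ∈ Complex.slitPlane) : v⁻¹ ∈ Complex.slitPlane := by
  have hn : 0 < Complex.normSq v := Complex.normSq_pos.2 (Complex.slitPlane_ne_zero hv)
  rw [Complex.mem_slitPlane_iff] at hv ⊢
  simp only [Complex.inv_re, Complex.inv_im]
  rcases hv with h | h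
  · left; positivity
  · right; simp [h, hn.ne']

lemma ofReal_mul_mem_slitPlane {u : ℝ} (hu : 0 < u) {v : ℂ} (hv : v ∈ Complex.slitPlane) :
    (u : ℂ) * v ∈ Complex.slitPlane := by
  rw [Complex.mem_slitPlane_iff] at hv ⊢
  simp only [Complex.re_ofReal_mul, Complex.im_ofReal_mul]
  rcases hv with h | h
  · left; positivity
  · right; positivity

open Set Filter Topology in
lemma integrable_ofReal_mul_cpow_neg {α : Type*} [MeasurableSpace α] {μ : Measure α} {k : ℝ}
    (hk : 0 < k) {w x y : α → ℝ} (hw : Measurable w) (hx : Measurable x) (hy : Measurable y)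
    (hx0 : ∀ᵐ t ∂μ, 0 ≤ x t) (hy0 : ∀ᵐ t ∂μ, 0 ≤ y t)
    (h_integrable : Integrable (fun t => w t * ((x t + 1) ^ (-k) * (y t + 1) ^ (-k))) μ) {s s' : ℂ}
    (hs : s ∈ Complex.slitPlane) (hs' : s' ∈ Complex.slitPlane) :
    Integrable (fun t => (w t : ℂ) * ((x t + s) ^ (-k : ℂ) * (y t + s') ^ (-k : ℂ))) μ := by
  obtain ⟨ε, hε, C, hC, h⟩ := exists_ball_norm_cpow_neg_le hk hs
  obtain ⟨ε', hε', C', hC', h'⟩ := exists_ball_norm_cpow_neg_le hk hs'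
  refine (h_integrable.norm.const_mul (C * C')).mono' (Measurable.aestronglyMeasurable (by fun_prop)) ?_
  filter_upwards [hx0, hy0] with t ht ht'
  have h1 := h s (Metric.mem_ball_self hε) _ ht
  have h2 := h' s' (Metric.mem_ball_self hε') _ ht'
  rw [norm_mul, norm_mul, norm_mul, Complex.norm_real,
    Real.norm_of_nonneg (by positivity : 0 ≤ (x t + 1) ^ (-k) * (y t + 1) ^ (-k))]
  calc ‖w t‖ * (‖((x t : ℂ) + s) ^ (-k : ℂ)‖ * ‖((y t : ℂ) + s') ^ (-k : ℂ)‖)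
      ≤ ‖w t‖ * ((C * (x t + 1) ^ (-k)) * (C' * (y t + 1) ^ (-k))) := by gcongr
    _ = _ := by ring

open Set Filter Topology in
lemma differentiableOn_integral_ofReal_mul_cpow_neg {α : Type*} [MeasurableSpace α] {μ : Measure α}
    {k : ℝ} (hk : 0 < k) {w x y : α → ℝ} (hw : Measurable w) (hx : Measurable x) (hy : Measurable y)
    (hx0 : ∀ᵐ t ∂μ, 0 ≤ x t) (hy0 : ∀ᵐ t ∂μ, 0 ≤ y t)
    (h_integrable : Integrable (fun t => w t * ((x t + 1) ^ (-k) * (y t + 1) ^ (-k))) μ) {u : ℝ}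
    (hu : 0 < u) :
    DifferentiableOn ℂ (fun v : ℂ =>
      ∫ t, (w t : ℂ) * ((x t + u * v) ^ (-k : ℂ) * (y t + u * v⁻¹) ^ (-k : ℂ)) ∂μ)
      Complex.slitPlane := by
  refine differentiableOn_integral_of_dominated Complex.isOpen_slitPlane ?_ ?_ ?_
  · intro z _
    exact Measurable.aestronglyMeasurable (by fun_prop)
  · filter_upwards [hx0, hy0] with t ht ht'
    refine (DifferentiableOn.mul ?_ ?_).const_mul _
    · exact (differentiableOn_ofReal_add_cpow ht _).comp
        (differentiableOn_id.const_mul _) (fun v hv => ofReal_mul_mem_slitPlane hu hv)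
    · exact (differentiableOn_ofReal_add_cpow ht' _).comp
        ((differentiableOn_id.inv fun v hv => Complex.slitPlane_ne_zero hv).const_mul _)
        (fun v hv => ofReal_mul_mem_slitPlane hu (inv_mem_slitPlane hv))
  · intro s₀ hs₀
    obtain ⟨ε, hε, C, hC, h⟩ := exists_ball_norm_cpow_neg_le hk (ofReal_mul_mem_slitPlane hu hs₀)
    obtain ⟨ε', hε', C', hC', h'⟩ := exists_ball_norm_cpow_neg_le hk
      (ofReal_mul_mem_slitPlane hu (inv_mem_slitPlane hs₀))
    have c1 : ∀ᶠ v in 𝓝 s₀, (u : ℂ) * v ∈ Metric.ball ((u : ℂ) * s₀) ε :=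
      (continuousAt_const.mul continuousAt_id).eventually (Metric.ball_mem_nhds _ hε)
    have c2 : ∀ᶠ v in 𝓝 s₀, (u : ℂ) * v⁻¹ ∈ Metric.ball ((u : ℂ) * s₀⁻¹) ε' :=
      (continuousAt_const.mul (continuousAt_inv₀ (Complex.slitPlane_ne_zero hs₀))).eventually
        (Metric.ball_mem_nhds _ hε')
    obtain ⟨η, hη, hηs⟩ := Metric.eventually_nhds_iff_ball.1 (c1.and c2)
    refine ⟨η, hη, _, h_integrable.norm.const_mul (C * C'), ?_⟩
    filter_upwards [hx0, hy0] with t ht ht' v hv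
    have h1 := h _ (hηs v hv).1 _ ht
    have h2 := h' _ (hηs v hv).2 _ ht'
    rw [norm_mul, norm_mul, norm_mul, Complex.norm_real,
      Real.norm_of_nonneg (by positivity : 0 ≤ (x t + 1) ^ (-k) * (y t + 1) ^ (-k))]
    calc ‖w t‖ * (‖((x t : ℂ) + u * v) ^ (-k : ℂ)‖ * ‖((y t : ℂ) + u * v⁻¹) ^ (-k : ℂ)‖)
        ≤ ‖w t‖ * ((C * (x t + 1) ^ (-k)) * (C' * (y t + 1) ^ (-k))) := by gcongr
      _ = _ := by ring

lemma ofReal_add_cpow_neg {x v k : ℝ} (h : 0 ≤ x + v) :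
    ((x : ℂ) + v) ^ (-k : ℂ) = (((x + v) ^ (-k) : ℝ) : ℂ) := by
  rw [Complex.ofReal_cpow h]; push_cast; rfl

open Set Filter Topology in
lemma IsHMDensity.exists_mixture_complex {k : ℝ} (hk : 0 < k) {f : ℝ → ℝ} (hf : IsHMDensity k f)
    (hfm : Measurable f) {r u : ℝ} (hr : 0 < r) (hu : 0 < u)
    (h_integrable : Integrable (fun t => (t⁻¹ * (f (r * t) * f (r / t))) *
      ((r * t + 1) ^ (-k) * (r / t + 1) ^ (-k))) (volume.restrict (Ioi 0))) :
    ∃ ν : Measure ℝ, (∀ᵐ b ∂ν, 0 ≤ b) ∧ Integrable (fun b : ℝ => (b + 1) ^ (-k)) ν ∧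
      ∀ v ∈ Complex.slitPlane,
        ∫ t in Ioi (0:ℝ), ((t⁻¹ * (f (r * t) * f (r / t)) : ℝ) : ℂ) *
          (((r * t : ℝ) + u * v) ^ (-k : ℂ) * ((r / t : ℝ) + u * v⁻¹) ^ (-k : ℂ))
        = ∫ b, ((b : ℂ) + (v + v⁻¹ + 2)) ^ (-k : ℂ) ∂ν := by
  obtain ⟨ν, hν0, hν⟩ := hf.exists_mixture hr hu
  have hν0' : ∀ᵐ b ∂ν, 0 ≤ b := by
    rw [ae_iff]; simpa [Iio_def] using hν0
  have hw : Measurable fun t => (t⁻¹ * (f (r * t) * f (r / t))) := by fun_prop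
  have hx : Measurable fun t => r * t := by fun_prop
  have hy : Measurable fun t => r / t := by fun_prop
  have hx0 : ∀ᵐ t ∂(volume.restrict (Ioi (0:ℝ))), 0 ≤ r * t := by
    filter_upwards [ae_restrict_mem measurableSet_Ioi] with t (ht : 0 < t) using by positivity
  have hy0 : ∀ᵐ t ∂(volume.restrict (Ioi (0:ℝ))), 0 ≤ r / t := by
    filter_upwards [ae_restrict_mem measurableSet_Ioi] with t (ht : 0 < t) using by positivity
  have hreal : ∀ v : ℝ, 0 < v → ∀ t ∈ Ioi (0:ℝ), ((t⁻¹ * (f (r * t) * f (r / t)) : ℝ) : ℂ) *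
          (((r * t : ℝ) + u * v) ^ (-k : ℂ) * ((r / t : ℝ) + u * (v:ℂ)⁻¹) ^ (-k : ℂ))
      = ((t⁻¹ * (f (r * t) * f (r / t)) * ((r * t + u * v) * (r / t + u / v)) ^ (-k) : ℝ) : ℂ) := by
    intro v hv t ht
    have ht : 0 < t := ht
    rw [mul_rpow (by positivity) (by positivity), ← Complex.ofReal_mul, ← Complex.ofReal_inv,
      ← Complex.ofReal_mul, ofReal_add_cpow_neg (by positivity), ofReal_add_cpow_neg (by positivity),
      ← div_eq_mul_inv]
    push_cast
    ring
  have hLi : ∀ v : ℝ, 0 < v → Integrable (fun t => t⁻¹ * (f (r * t) * f (r / t)) *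
      ((r * t + u * v) * (r / t + u / v)) ^ (-k)) (volume.restrict (Ioi 0)) := by
    intro v hv
    have hvs : (v : ℂ) ∈ Complex.slitPlane := Complex.ofReal_mem_slitPlane.2 hv
    have h1 := (integrable_ofReal_mul_cpow_neg hk hw hx hy hx0 hy0 h_integrable
      (ofReal_mul_mem_slitPlane hu hvs) (ofReal_mul_mem_slitPlane hu (inv_mem_slitPlane hvs))).re
    refine h1.congr ?_
    filter_upwards [ae_restrict_mem measurableSet_Ioi] with t ht
    rw [hreal v hv t ht]
    simp
  have hL0 : ∀ v : ℝ, 0 < v → 0 ≤ᵐ[volume.restrict (Ioi 0)] (fun t => t⁻¹ * (f (r * t) * f (r / t)) *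
      ((r * t + u * v) * (r / t + u / v)) ^ (-k)) := by
    intro v hv
    filter_upwards [ae_restrict_mem measurableSet_Ioi] with t (ht : 0 < t)
    have := hf.1 (r * t)
    have := hf.1 (r / t)
    positivity
  have hνi : Integrable (fun b : ℝ => (b + 1) ^ (-k)) ν := by
    have h1 := hν 1 one_pos
    rw [← ofReal_integral_eq_lintegral_ofReal (hLi 1 one_pos) (hL0 1 one_pos)] at h1
    have h2 : Integrable (fun b : ℝ => (b + (1 + 1⁻¹ + 2)) ^ (-k)) ν := by
      refine ⟨Measurable.aestronglyMeasurable (by fun_prop), ?_⟩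
      rw [hasFiniteIntegral_iff_ofReal, ← h1]
      · exact ENNReal.ofReal_lt_top
      · filter_upwards [hν0'] with b hb
        show 0 ≤ (b + (1 + 1⁻¹ + 2)) ^ (-k)
        positivity
    refine (h2.const_mul (4 ^ k)).mono' (Measurable.aestronglyMeasurable (by fun_prop)) ?_
    filter_upwards [hν0'] with b hb
    rw [Real.norm_of_nonneg (by positivity), show (4:ℝ) ^ k = (4⁻¹) ^ (-k) by
      rw [inv_rpow (by norm_num), rpow_neg (by norm_num), inv_inv],
      ← mul_rpow (by norm_num) (by positivity)]
    exact rpow_le_rpow_of_nonpos (by positivity) (by linarith) (by linarith)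
  refine ⟨ν, hν0', hνi, ?_⟩
  have hA1 := (differentiableOn_integral_ofReal_mul_cpow_neg hk hw hx hy hx0 hy0 h_integrable
    hu).analyticOnNhd Complex.isOpen_slitPlane
  have hA2 : AnalyticOnNhd ℂ (fun v : ℂ => ∫ b, ((b : ℂ) + (v + v⁻¹ + 2)) ^ (-k : ℂ) ∂ν)
      Complex.slitPlane := by
    refine DifferentiableOn.analyticOnNhd ?_ Complex.isOpen_slitPlane
    exact (differentiableOn_integral_cpow_neg hk hν0' hνi).comp
      ((differentiableOn_id.add (differentiableOn_id.inv
        fun v hv => Complex.slitPlane_ne_zero hv)).add_const _)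
      (fun v hv => add_inv_add_two_mem_slitPlane hv)
  refine hA1.eqOn_of_preconnected_of_frequently_eq hA2
    (Complex.starConvex_one_slitPlane.isPathConnected (by simp)).isConnected.isPreconnected (z₀ := 1) (by simp) ?_
  have hfr : ∀ v : ℝ, 0 < v → ∫ t in Ioi (0:ℝ), ((t⁻¹ * (f (r * t) * f (r / t)) : ℝ) : ℂ) *
          (((r * t : ℝ) + u * v) ^ (-k : ℂ) * ((r / t : ℝ) + u * (v:ℂ)⁻¹) ^ (-k : ℂ))
        = ∫ b, ((b : ℂ) + (v + (v:ℂ)⁻¹ + 2)) ^ (-k : ℂ) ∂ν := by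
    intro v hv
    rw [setIntegral_congr_fun measurableSet_Ioi (hreal v hv), integral_complex_ofReal]
    have e : ∀ᵐ b : ℝ ∂ν, ((b : ℂ) + (v + (v:ℂ)⁻¹ + 2)) ^ (-k : ℂ)
        = (((b + (v + v⁻¹ + 2)) ^ (-k) : ℝ) : ℂ) := by
      filter_upwards [hν0'] with b hb
      rw [← ofReal_add_cpow_neg (by positivity)]
      push_cast; rfl
    rw [integral_congr_ae e, integral_complex_ofReal, integral_eq_lintegral_of_nonneg_ae (hL0 v hv)
      (hLi v hv).1, integral_eq_lintegral_of_nonneg_ae _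
      (Measurable.aestronglyMeasurable (by fun_prop)), hν v hv]
    filter_upwards [hν0'] with b hb
    show 0 ≤ (b + (v + v⁻¹ + 2)) ^ (-k)
    positivity
  have hlim : Tendsto (fun n : ℕ => ((1 + 1 / ((n:ℝ) + 1) : ℝ) : ℂ)) atTop (𝓝[≠] 1) := by
    refine tendsto_nhdsWithin_iff.2 ⟨?_, ?_⟩
    · have := (Complex.continuous_ofReal.tendsto _).comp
        ((tendsto_one_div_add_atTop_nhds_zero_nat (𝕜 := ℝ)).const_add 1)
      simpa [Function.comp_def] using! this
    · refine Eventually.of_forall fun n => ?_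
      have : (1 + 1 / ((n:ℝ) + 1) : ℝ) ≠ 1 := by
        have : 0 < 1 / ((n:ℝ) + 1) := by positivity
        linarith
      simpa using fun h => this (Complex.ofReal_eq_one.1 h)
  exact hlim.frequently (Frequently.of_forall fun n => hfr _ (by positivity))

open Set in
lemma lintegral_Ioi_comp_mul {a : ℝ} (ha : 0 < a) (g : ℝ → ENNReal) :
    ∫⁻ x in Ioi 0, g x = ENNReal.ofReal a * ∫⁻ x in Ioi 0, g (a * x) := by
  have h : Ioi (0:ℝ) = (fun x => a * x) '' Ioi 0 := by
    rw [image_mul_left_Ioi ha, mul_zero]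
  conv_lhs => rw [h]
  rw [lintegral_image_eq_lintegral_abs_deriv_mul measurableSet_Ioi
    (f' := fun _ => a) (fun x _ => by simpa using ((hasDerivAt_id x).const_mul a).hasDerivWithinAt)
    (fun x _ y _ hxy => mul_left_cancel₀ ha.ne' hxy), abs_of_pos ha,
    lintegral_const_mul' _ _ ENNReal.ofReal_ne_top]

open Set in
lemma lintegral_Ioi_comp_sq (g : ℝ → ENNReal) :
    ∫⁻ x in Ioi 0, g x = ∫⁻ x in Ioi 0, ENNReal.ofReal (2 * x) * g (x ^ 2) := by
  have h : Ioi (0:ℝ) = (fun x => x ^ 2) '' Ioi 0 := by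
    ext x
    constructor
    · intro (hx : 0 < x)
      exact ⟨√x, Real.sqrt_pos.2 hx, Real.sq_sqrt hx.le⟩
    · rintro ⟨y, hy : 0 < y, rfl⟩
      show 0 < y ^ 2
      positivity
  conv_lhs => rw [h]
  rw [lintegral_image_eq_lintegral_abs_deriv_mul measurableSet_Ioi
    (f' := fun x => 2 * x) (fun x _ => by simpa using (hasDerivAt_pow 2 x).hasDerivWithinAt)
    (fun x (hx : 0 < x) y (hy : 0 < y) hxy => by
      simpa using (pow_left_inj₀ hx.le hy.le two_ne_zero).1 hxy)]
  refine setLIntegral_congr_fun measurableSet_Ioi fun x (hx : 0 < x) => ?_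
  simp only [abs_of_pos (by positivity : 0 < 2 * x)]

open Set in
lemma lintegral_Ioi_hyperbolic {h : ℝ × ℝ → ENNReal} (hm : Measurable h) :
    ∫⁻ x in Ioi (0:ℝ), ∫⁻ y in Ioi (0:ℝ), h (x, y)
      = ∫⁻ r in Ioi (0:ℝ), ∫⁻ t in Ioi (0:ℝ), ENNReal.ofReal (2 * r * t⁻¹) * h (r * t, r / t) := by
  have e1 : ∀ x ∈ Ioi (0:ℝ), ∫⁻ y in Ioi (0:ℝ), h (x, y)
      = ∫⁻ q in Ioi (0:ℝ), ENNReal.ofReal x⁻¹ * h (x, x⁻¹ * q) := by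
    intro x (hx : 0 < x)
    rw [lintegral_Ioi_comp_mul (inv_pos.2 hx), lintegral_const_mul' _ _ ENNReal.ofReal_ne_top]
  rw [setLIntegral_congr_fun measurableSet_Ioi e1,
    lintegral_lintegral_swap (f := fun x q => ENNReal.ofReal x⁻¹ * h (x, x⁻¹ * q))
      (Measurable.aemeasurable (by fun_prop)), lintegral_Ioi_comp_sq]
  refine setLIntegral_congr_fun measurableSet_Ioi fun r (hr : 0 < r) => ?_
  rw [lintegral_Ioi_comp_mul hr, ← mul_assoc, ← lintegral_const_mul' _ _ (by finiteness)]
  refine setLIntegral_congr_fun measurableSet_Ioi fun t (ht : 0 < t) => ?_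
  rw [← ENNReal.ofReal_mul (by positivity), ← mul_assoc, ← ENNReal.ofReal_mul (by positivity)]
  congr 1
  · congr 1
    field_simp
  · congr 2
    field_simp

/-- The measure `f(x) x^k dx` on `(0, ∞)`. -/
noncomputable def powDensityMeasure (k : ℝ) (f : ℝ → ℝ) : Measure ℝ :=
  (volume.restrict (Set.Ioi 0)).withDensity fun x => ENNReal.ofReal (f x * x ^ k)

instance (k : ℝ) (f : ℝ → ℝ) : SFinite (powDensityMeasure k f) := by
  unfold powDensityMeasure; infer_instance

open Set in
lemma powDensityMeasure_prod_self {k : ℝ} {f : ℝ → ℝ} (hfm : Measurable f) (hf0 : ∀ x, 0 ≤ f x) :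
    (powDensityMeasure k f).prod (powDensityMeasure k f) =
      (((volume.restrict (Ioi (0:ℝ))).prod (volume.restrict (Ioi (0:ℝ)))).withDensity
        fun z => ENNReal.ofReal (2 * z.1 ^ (2 * k + 1) *
          (z.2⁻¹ * (f (z.1 * z.2) * f (z.1 / z.2))))).map (fun z => (z.1 * z.2, z.1 / z.2)) := by
  refine Measure.ext_of_lintegral _ fun h hh => ?_
  rw [lintegral_prod _ hh.aemeasurable, lintegral_map hh (by fun_prop),
    lintegral_withDensity_eq_lintegral_mul _ (by fun_prop) (by fun_prop),
    lintegral_prod _ (Measurable.aemeasurable (by fun_prop))]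
  have hw : Measurable fun x : ℝ => ENNReal.ofReal (f x * x ^ k) := by fun_prop
  unfold powDensityMeasure
  rw [lintegral_withDensity_eq_lintegral_mul _ hw (Measurable.lintegral_prod_right (by fun_prop))]
  have e1 : ∀ x : ℝ, ∫⁻ y, h (x, y) ∂((volume.restrict (Ioi 0)).withDensity
      fun x => ENNReal.ofReal (f x * x ^ k)) = ∫⁻ y in Ioi 0, ENNReal.ofReal (f y * y ^ k) * h (x, y) := by
    intro x
    rw [lintegral_withDensity_eq_lintegral_mul _ hw (by fun_prop)]
    rfl
  simp only [Pi.mul_apply, e1]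
  have e2 : ∀ x : ℝ, ENNReal.ofReal (f x * x ^ k) * ∫⁻ y in Ioi 0, ENNReal.ofReal (f y * y ^ k) * h (x, y)
      = ∫⁻ y in Ioi 0, ENNReal.ofReal (f x * x ^ k) * (ENNReal.ofReal (f y * y ^ k) * h (x, y)) :=
    fun x => by rw [lintegral_const_mul' _ _ ENNReal.ofReal_ne_top]
  simp only [e2]
  rw [lintegral_Ioi_hyperbolic (h := fun z => ENNReal.ofReal (f z.1 * z.1 ^ k) *
    (ENNReal.ofReal (f z.2 * z.2 ^ k) * h z)) (by fun_prop)]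
  refine setLIntegral_congr_fun measurableSet_Ioi fun r (hr : 0 < r) => ?_
  refine setLIntegral_congr_fun measurableSet_Ioi fun t (ht : 0 < t) => ?_
  simp only
  have := hf0 (r * t)
  have := hf0 (r / t)
  rw [← mul_assoc, ← mul_assoc, ← ENNReal.ofReal_mul (by positivity), ← ENNReal.ofReal_mul (by positivity)]
  congr 2
  rw [mul_rpow hr.le ht.le, div_rpow hr.le ht.le, rpow_add_one hr.ne', two_mul k, rpow_add hr]
  field_simp

lemma powDensityMeasure_ae_pos (k : ℝ) (f : ℝ → ℝ) : ∀ᵐ x ∂(powDensityMeasure k f), 0 < x :=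
  (withDensity_absolutelyContinuous _ _).ae_le (ae_restrict_mem measurableSet_Ioi)

lemma powDensityMeasure_ae_nonneg (k : ℝ) (f : ℝ → ℝ) : ∀ᵐ x ∂(powDensityMeasure k f), 0 ≤ x :=
  (powDensityMeasure_ae_pos k f).mono fun _ h => h.le

open Set in
lemma integrable_powDensityMeasure {k : ℝ} (hk : 0 < k) {f : ℝ → ℝ} (hfm : Measurable f)
    (hf0 : ∀ x, 0 ≤ f x) (hf1 : ∫⁻ x in Ioi 0, ENNReal.ofReal (f x) = 1) :
    Integrable (fun x : ℝ => (x + 1) ^ (-k)) (powDensityMeasure k f) := by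
  refine ⟨Measurable.aestronglyMeasurable (by fun_prop), ?_⟩
  rw [hasFiniteIntegral_iff_ofReal]
  swap
  · filter_upwards [powDensityMeasure_ae_pos k f] with x hx
    show 0 ≤ (x + 1) ^ (-k)
    positivity
  unfold powDensityMeasure
  rw [lintegral_withDensity_eq_lintegral_mul _ (by fun_prop) (by fun_prop)]
  refine lt_of_le_of_lt (b := 1) ?_ ENNReal.one_lt_top
  rw [← hf1]
  refine setLIntegral_mono' measurableSet_Ioi fun x (hx : 0 < x) => ?_
  have := hf0 x
  rw [Pi.mul_apply, ← ENNReal.ofReal_mul (by positivity)]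
  refine ENNReal.ofReal_le_ofReal ?_
  rw [mul_assoc, rpow_neg (by positivity), ← div_eq_mul_inv, ← div_rpow (by positivity) (by positivity)]
  refine mul_le_of_le_one_right this (rpow_le_one (by positivity) ?_ hk.le)
  rw [div_le_one (by positivity)]
  linarith

/-- The Laplace transform of `Y / X` for `Y ∼ Gamma(k)` and `X ∼ f`, extended to the slit plane. -/
noncomputable def stieltjesTransform (k : ℝ) (f : ℝ → ℝ) (s : ℂ) : ℂ :=
  ∫ x, ((x : ℂ) + s) ^ (-k : ℂ) ∂(powDensityMeasure k f)

lemma ofReal_add_cpow_conj {x k : ℝ} (hx : 0 ≤ x) {s : ℂ} (hs : s ∈ Complex.slitPlane) :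
    ((x : ℂ) + (starRingEnd ℂ) s) ^ (-k : ℂ) = (starRingEnd ℂ) (((x : ℂ) + s) ^ (-k : ℂ)) := by
  have h := ofReal_add_mem_slitPlane hx hs
  have := Complex.conj_cpow ((x : ℂ) + s) (-k : ℂ) (Complex.mem_slitPlane_iff_arg.1 h).1
  simpa using! this

lemma conj_mem_slitPlane {s : ℂ} (hs : s ∈ Complex.slitPlane) :
    (starRingEnd ℂ) s ∈ Complex.slitPlane := by
  rw [Complex.mem_slitPlane_iff] at hs ⊢
  simpa using hs

lemma stieltjesTransform_conj {k : ℝ} {f : ℝ → ℝ} {s : ℂ} (hs : s ∈ Complex.slitPlane) :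
    stieltjesTransform k f ((starRingEnd ℂ) s) = (starRingEnd ℂ) (stieltjesTransform k f s) := by
  unfold stieltjesTransform
  rw [← integral_conj]
  refine integral_congr_ae ?_
  filter_upwards [powDensityMeasure_ae_nonneg k f] with x hx using ofReal_add_cpow_conj hx hs

open Set in
lemma IsHMDensity.norm_stieltjesTransform_le {k : ℝ} (hk : 0 < k) {f : ℝ → ℝ}
    (hf : IsHMDensity k f) (hfm : Measurable f) {s₁ s₂ : ℂ} (h₁ : s₁ ∈ Complex.slitPlane)
    (h₂ : s₂ ∈ Complex.slitPlane) (hn : ‖s₁‖ = ‖s₂‖) (hre : s₂.re ≤ s₁.re) :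
    ‖stieltjesTransform k f s₁‖ ≤ ‖stieltjesTransform k f s₂‖ := by
  set ρ := volume.restrict (Ioi (0:ℝ)) with hρ
  have h_integrable := integrable_powDensityMeasure hk hfm hf.1 hf.2.1
  let F : ℂ → ℝ × ℝ → ℂ := fun s z => ((z.1 * z.2 : ℝ) + s) ^ (-k : ℂ) *
    ((z.1 / z.2 : ℝ) + (starRingEnd ℂ) s) ^ (-k : ℂ)
  let W : ℝ × ℝ → ℝ := fun z => 2 * z.1 ^ (2 * k + 1) * (z.2⁻¹ * (f (z.1 * z.2) * f (z.1 / z.2)))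
  have hWm : Measurable W := by fun_prop
  have hW0 : ∀ᵐ z ∂(ρ.prod ρ), 0 ≤ W z := by
    rw [hρ, Measure.prod_restrict]
    filter_upwards [ae_restrict_mem (measurableSet_Ioi.prod measurableSet_Ioi)] with z hz
    have h1 : 0 < z.1 := hz.1
    have h2 : 0 < z.2 := hz.2
    have := hf.1 (z.1 * z.2)
    have := hf.1 (z.1 / z.2)
    positivity
  have hFm : ∀ s, Measurable (F s) := fun s => by fun_prop
  have hmap := powDensityMeasure_prod_self (k := k) hfm hf.1
  have hmm : Measurable fun z : ℝ × ℝ => (z.1 * z.2, z.1 / z.2) := by fun_prop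
  have htop : ∀ᵐ z ∂(ρ.prod ρ), ENNReal.ofReal (W z) < ⊤ :=
    Filter.Eventually.of_forall fun z => ENNReal.ofReal_lt_top
  have hFi : ∀ s ∈ Complex.slitPlane, Integrable (fun z => (W z : ℂ) * F s z) (ρ.prod ρ) := by
    intro s hs
    have h1 := (integrable_cpow_neg hk (powDensityMeasure_ae_nonneg k f) h_integrable hs).mul_prod
      (integrable_cpow_neg hk (powDensityMeasure_ae_nonneg k f) h_integrable (conj_mem_slitPlane hs))
    rw [hmap, integrable_map_measure (Measurable.aestronglyMeasurable (by fun_prop))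
      hmm.aemeasurable, integrable_withDensity_iff_integrable_smul' (by fun_prop) htop] at h1
    refine h1.congr ?_
    filter_upwards [hW0] with z hz
    simp only [ENNReal.toReal_ofReal hz, Complex.real_smul, W, F, Function.comp]
  have hFe : ∀ s ∈ Complex.slitPlane, ((‖stieltjesTransform k f s‖ ^ 2 : ℝ) : ℂ)
      = ∫ r in Ioi (0:ℝ), ∫ t in Ioi (0:ℝ), (W (r, t) : ℂ) * F s (r, t) := by
    intro s hs
    rw [← integral_prod _ (hFi s hs), ← Complex.normSq_eq_norm_sq, ← Complex.mul_conj,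
      ← stieltjesTransform_conj hs]
    unfold stieltjesTransform
    rw [← integral_prod_mul, hmap, integral_map hmm.aemeasurable
      (Measurable.aestronglyMeasurable (by fun_prop)),
      integral_withDensity_eq_integral_toReal_smul (by fun_prop) htop]
    refine integral_congr_ae ?_
    filter_upwards [hW0] with z hz
    simp only [ENNReal.toReal_ofReal hz, Complex.real_smul, W, F]
  have hs0 : 0 < ‖s₁‖ := norm_pos_iff.2 (Complex.slitPlane_ne_zero h₁)
  have hmain : ∀ᵐ r ∂ρ, (∫ t in Ioi (0:ℝ), (W (r, t) : ℂ) * F s₁ (r, t)).re ≤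
      (∫ t in Ioi (0:ℝ), (W (r, t) : ℂ) * F s₂ (r, t)).re := by
    filter_upwards [(hFi 1 (by simp)).prod_right_ae, ae_restrict_mem measurableSet_Ioi]
      with r hr1 (hr : 0 < r)
    have hr2 : Integrable (fun t => (t⁻¹ * (f (r * t) * f (r / t))) *
      ((r * t + 1) ^ (-k) * (r / t + 1) ^ (-k))) (volume.restrict (Ioi 0)) := by
      refine (hr1.re.const_mul (2 * r ^ (2 * k + 1))⁻¹).congr ?_
      filter_upwards [ae_restrict_mem measurableSet_Ioi] with t (ht : 0 < t)
      have e : (W (r, t) : ℂ) * F 1 (r, t) = ((W (r, t) *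
          ((r * t + 1) ^ (-k) * (r / t + 1) ^ (-k)) : ℝ) : ℂ) := by
        simp only [F]
        rw [map_one, ← Complex.ofReal_one, ofReal_add_cpow_neg (by positivity),
          ofReal_add_cpow_neg (by positivity)]
        push_cast; rfl
      rw [e]
      simp only [W, RCLike.re_to_complex, Complex.ofReal_re]
      field_simp
    obtain ⟨ν, hν0, hνi, hν⟩ := hf.exists_mixture_complex hk hfm hr hs0 hr2
    have hval : ∀ s ∈ Complex.slitPlane, ‖s‖ = ‖s₁‖ →
        0 < 2 * (s.re / ‖s₁‖) + 2 ∧ ∫ t in Ioi (0:ℝ), (W (r, t) : ℂ) * F s (r, t)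
          = ((2 * r ^ (2 * k + 1) * ∫ b, (b + (2 * (s.re / ‖s₁‖) + 2)) ^ (-k) ∂ν : ℝ) : ℂ) := by
      intro s hs hsn
      have hv : ((‖s₁‖⁻¹ : ℝ) : ℂ) * s ∈ Complex.slitPlane :=
        ofReal_mul_mem_slitPlane (inv_pos.2 hs0) hs
      have hne : (‖s₁‖ : ℂ) ≠ 0 := Complex.ofReal_ne_zero.2 hs0.ne'
      have e1 : (‖s₁‖ : ℂ) * (((‖s₁‖⁻¹ : ℝ) : ℂ) * s) = s := by
        push_cast; field_simp
      have e2 : (((‖s₁‖⁻¹ : ℝ) : ℂ) * s)⁻¹ = ((‖s₁‖⁻¹ : ℝ) : ℂ) * (starRingEnd ℂ) s := by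
        rw [mul_inv, Complex.inv_def s, Complex.normSq_eq_norm_sq, hsn]
        push_cast; field_simp
      have e3 : (‖s₁‖ : ℂ) * (((‖s₁‖⁻¹ : ℝ) : ℂ) * s)⁻¹ = (starRingEnd ℂ) s := by
        rw [e2]; push_cast; field_simp
      have e4 : ((‖s₁‖⁻¹ : ℝ) : ℂ) * s + (((‖s₁‖⁻¹ : ℝ) : ℂ) * s)⁻¹ + 2
          = ((2 * (s.re / ‖s₁‖) + 2 : ℝ) : ℂ) := by
        rw [e2, ← mul_add, Complex.add_conj]; push_cast; ring
      have hpos := add_inv_add_two_mem_slitPlane hv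
      rw [e4, Complex.ofReal_mem_slitPlane] at hpos
      refine ⟨hpos, ?_⟩
      have h3 := hν _ hv
      rw [e4, e1, e3] at h3
      have h4 : ∫ b : ℝ, ((b : ℂ) + ((2 * (s.re / ‖s₁‖) + 2 : ℝ) : ℂ)) ^ (-k : ℂ) ∂ν
          = ((∫ b, (b + (2 * (s.re / ‖s₁‖) + 2)) ^ (-k) ∂ν : ℝ) : ℂ) := by
        rw [← integral_complex_ofReal]
        refine integral_congr_ae ?_
        filter_upwards [hν0] with b hb using ofReal_add_cpow_neg (by positivity)
      rw [Complex.ofReal_mul, ← h4, ← h3, ← integral_const_mul]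
      refine setIntegral_congr_fun measurableSet_Ioi fun t ht => ?_
      simp only [W, F]
      push_cast
      ring
    obtain ⟨p1, q1⟩ := hval s₁ h₁ rfl
    obtain ⟨p2, q2⟩ := hval s₂ h₂ hn.symm
    rw [q1, q2, Complex.ofReal_re, Complex.ofReal_re]
    have hνint : ∀ c : ℝ, 0 < c → Integrable (fun b : ℝ => (b + c) ^ (-k)) ν := by
      intro c hc
      refine (integrable_cpow_neg hk hν0 hνi (Complex.ofReal_mem_slitPlane.2 hc)).re.congr ?_
      filter_upwards [hν0] with b hb
      rw [ofReal_add_cpow_neg (by positivity)]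
      simp
    refine mul_le_mul_of_nonneg_left ?_ (by positivity)
    refine integral_mono_ae (hνint _ p1) (hνint _ p2) ?_
    filter_upwards [hν0] with b hb
    refine rpow_le_rpow_of_nonpos (by positivity) ?_ (by linarith)
    gcongr
  have hre1 : ∀ s ∈ Complex.slitPlane, ‖stieltjesTransform k f s‖ ^ 2
      = ∫ r in Ioi (0:ℝ), (∫ t in Ioi (0:ℝ), (W (r, t) : ℂ) * F s (r, t)).re := by
    intro s hs
    have h1 := congrArg Complex.re (hFe s hs)
    rw [Complex.ofReal_re] at h1
    rw [h1]
    exact (integral_re (hFi s hs).integral_prod_left).symm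
  refine le_of_sq_le_sq ?_ (norm_nonneg _)
  rw [hre1 s₁ h₁, hre1 s₂ h₂]
  exact integral_mono_ae (hFi s₁ h₁).integral_prod_left.re (hFi s₂ h₂).integral_prod_left.re hmain

open Set in
lemma stieltjesTransform_ofReal {k u : ℝ} {f : ℝ → ℝ} (hu : 0 ≤ u) :
    stieltjesTransform k f u = ((∫ x, (x + u) ^ (-k) ∂(powDensityMeasure k f) : ℝ) : ℂ) := by
  unfold stieltjesTransform
  rw [← integral_complex_ofReal]
  refine integral_congr_ae ?_
  filter_upwards [powDensityMeasure_ae_nonneg k f] with x hx using ofReal_add_cpow_neg (by positivity)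

open Set in
lemma powDensityMeasure_ne_zero {k : ℝ} {f : ℝ → ℝ} (hfm : Measurable f)
    (hf1 : ∫⁻ x in Ioi 0, ENNReal.ofReal (f x) = 1) : powDensityMeasure k f ≠ 0 := by
  intro h
  unfold powDensityMeasure at h
  rw [withDensity_eq_zero_iff (Measurable.aemeasurable (by fun_prop))] at h
  have : ∫⁻ x in Ioi 0, ENNReal.ofReal (f x) = 0 := by
    rw [lintegral_eq_zero_iff (by fun_prop)]
    filter_upwards [h, ae_restrict_mem measurableSet_Ioi] with x hx (hx0 : 0 < x)
    simp only [Pi.zero_apply, ENNReal.ofReal_eq_zero] at hx ⊢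
    exact nonpos_of_mul_nonpos_left hx (by positivity)
  simp [this] at hf1

open Set in
lemma stieltjesTransform_real_pos {k u : ℝ} (hk : 0 < k) {f : ℝ → ℝ} (hfm : Measurable f)
    (hf0 : ∀ x, 0 ≤ f x) (hf1 : ∫⁻ x in Ioi 0, ENNReal.ofReal (f x) = 1) (hu : 0 < u) :
    0 < ∫ x, (x + u) ^ (-k) ∂(powDensityMeasure k f) := by
  have h_integrable : Integrable (fun x : ℝ => (x + u) ^ (-k)) (powDensityMeasure k f) := by
    refine (integrable_cpow_neg hk (powDensityMeasure_ae_nonneg k f)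
      (integrable_powDensityMeasure hk hfm hf0 hf1) (Complex.ofReal_mem_slitPlane.2 hu)).re.congr ?_
    filter_upwards [powDensityMeasure_ae_nonneg k f] with b hb
    rw [ofReal_add_cpow_neg (by positivity)]
    simp
  have hpos : ∀ᵐ x ∂(powDensityMeasure k f), 0 < (x + u) ^ (-k) := by
    filter_upwards [powDensityMeasure_ae_nonneg k f] with x hx using by positivity
  refine lt_of_le_of_ne (integral_nonneg_of_ae (hpos.mono fun _ h => h.le)) fun h => ?_
  rw [eq_comm, integral_eq_zero_iff_of_nonneg_ae (hpos.mono fun _ h => h.le) h_integrable] at h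
  refine powDensityMeasure_ne_zero (k := k) hfm hf1 ?_
  rw [← ae_eq_bot, ← Filter.eventually_false_iff_eq_bot]
  filter_upwards [h, hpos] with x h1 h2 using h2.ne' h1

lemma differentiableOn_stieltjesTransform {k : ℝ} (hk : 0 < k) {f : ℝ → ℝ} (hfm : Measurable f)
    (hf0 : ∀ x, 0 ≤ f x) (hf1 : ∫⁻ x in Set.Ioi 0, ENNReal.ofReal (f x) = 1) :
    DifferentiableOn ℂ (stieltjesTransform k f) Complex.slitPlane :=
  differentiableOn_integral_cpow_neg hk (powDensityMeasure_ae_nonneg k f)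
    (integrable_powDensityMeasure hk hfm hf0 hf1)

lemma IsHMDensity.stieltjesTransform_ne_zero {k : ℝ} (hk : 0 < k) {f : ℝ → ℝ}
    (hf : IsHMDensity k f) (hfm : Measurable f) {s : ℂ} (hs : s ∈ Complex.slitPlane) :
    stieltjesTransform k f s ≠ 0 := by
  have hs0 : 0 < ‖s‖ := norm_pos_iff.2 (Complex.slitPlane_ne_zero hs)
  have h1 := hf.norm_stieltjesTransform_le hk hfm (Complex.ofReal_mem_slitPlane.2 hs0) hs
    (by simp) (by simpa using Complex.re_le_norm s)
  have h2 := stieltjesTransform_real_pos hk hfm hf.1 hf.2.1 hs0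
  rw [stieltjesTransform_ofReal hs0.le, Complex.norm_real, Real.norm_of_nonneg h2.le] at h1
  exact norm_pos_iff.1 (h2.trans_le h1)

/-- The function `s ↦ -s φ'(s) / φ(s)` for `φ` the transform of `f`. -/
noncomputable def thorinFunction (k : ℝ) (f : ℝ → ℝ) (s : ℂ) : ℂ :=
  -(s * deriv (stieltjesTransform k f) s / stieltjesTransform k f s)

lemma IsHMDensity.differentiableOn_thorinFunction {k : ℝ} (hk : 0 < k) {f : ℝ → ℝ}
    (hf : IsHMDensity k f) (hfm : Measurable f) :
    DifferentiableOn ℂ (thorinFunction k f) Complex.slitPlane := by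
  have h := differentiableOn_stieltjesTransform hk hfm hf.1 hf.2.1
  exact ((differentiableOn_id.mul (h.deriv Complex.isOpen_slitPlane)).div h
    (fun s hs => hf.stieltjesTransform_ne_zero hk hfm hs)).neg

open Filter Topology in
lemma IsHMDensity.thorinFunction_im_mul_im_nonneg {k : ℝ} (hk : 0 < k) {f : ℝ → ℝ}
    (hf : IsHMDensity k f) (hfm : Measurable f) {s : ℂ} (hs : s ∈ Complex.slitPlane) :
    0 ≤ (thorinFunction k f s).im * s.im := by
  set φ := stieltjesTransform k f with hφ
  have hd : HasDerivAt φ (deriv φ s) s :=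
    ((differentiableOn_stieltjesTransform hk hfm hf.1 hf.2.1).differentiableAt
      (Complex.isOpen_slitPlane.mem_nhds hs)).hasDerivAt
  have hφ0 : φ s ≠ 0 := hf.stieltjesTransform_ne_zero hk hfm hs
  let ψ : ℝ → ℂ := fun θ => s * Complex.exp (θ * Complex.I)
  have hψ0 : ψ 0 = s := by simp [ψ]
  have hψ : HasDerivAt ψ (s * Complex.I) 0 := by
    have h1 : HasDerivAt (fun θ : ℝ => (θ : ℂ) * Complex.I) Complex.I 0 := by
      simpa using (Complex.ofRealCLM.hasDerivAt (x := (0:ℝ))).mul_const Complex.I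
    simpa [ψ] using (h1.cexp).const_mul s
  have hψn : ∀ θ, ‖ψ θ‖ = ‖s‖ := fun θ => by simp [ψ, Complex.norm_exp_ofReal_mul_I]
  have hψm : ∀ᶠ θ in 𝓝 0, ψ θ ∈ Complex.slitPlane :=
    hψ.continuousAt.eventually_mem (by rw [hψ0]; exact Complex.isOpen_slitPlane.mem_nhds hs)
  have hm : HasDerivAt (fun θ => ‖φ (ψ θ)‖ ^ 2) (2 * inner ℝ (φ s) (deriv φ s * (s * Complex.I))) 0 := by
    have h2 : HasDerivAt (φ ∘ ψ) (deriv φ s * (s * Complex.I)) 0 := by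
      refine HasDerivAt.comp (𝕜 := ℝ) (𝕜' := ℂ) 0 ?_ hψ
      rwa [hψ0]
    have := h2.norm_sq
    simpa [hψ0] using this
  have hh : HasDerivAt (fun θ => (ψ θ).re) (-s.im) 0 := by
    have := (Complex.reCLM.hasFDerivAt.comp_hasDerivAt 0 hψ)
    simpa using! this
  rw [hasDerivAt_iff_tendsto_slope] at hm hh
  have hlim := hm.mul hh
  have hle : 2 * inner ℝ (φ s) (deriv φ s * (s * Complex.I)) * -s.im ≤ 0 := by
    refine le_of_tendsto hlim ?_
    filter_upwards [hψm.filter_mono nhdsWithin_le_nhds, self_mem_nhdsWithin] with θ hθ hθ0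
    have hθ0 : θ ≠ 0 := hθ0
    simp only [slope_def_field, hψ0, sub_zero]
    rw [div_mul_div_comm]
    refine div_nonpos_of_nonpos_of_nonneg ?_ (mul_self_nonneg θ)
    rcases le_total (ψ θ).re s.re with h | h
    · have := hf.norm_stieltjesTransform_le hk hfm hs hθ (hψn θ).symm h
      have : ‖φ s‖ ^ 2 ≤ ‖φ (ψ θ)‖ ^ 2 := by gcongr
      exact mul_nonpos_of_nonneg_of_nonpos (by linarith) (by linarith)
    · have := hf.norm_stieltjesTransform_le hk hfm hθ hs (hψn θ) h
      have : ‖φ (ψ θ)‖ ^ 2 ≤ ‖φ s‖ ^ 2 := by gcongr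
      exact mul_nonpos_of_nonpos_of_nonneg (by linarith) (by linarith)
  have hin : inner ℝ (φ s) (deriv φ s * (s * Complex.I))
      = Complex.normSq (φ s) * (thorinFunction k f s).im := by
    have e : deriv φ s * s = -(thorinFunction k f s * φ s) := by
      simp only [thorinFunction, ← hφ]; field_simp
    rw [Complex.inner, ← mul_assoc, e, Complex.normSq_apply]
    simp only [Complex.mul_re, Complex.mul_im, Complex.neg_re, Complex.neg_im, Complex.conj_re,
      Complex.conj_im, Complex.I_re, Complex.I_im]
    ring
  rw [hin] at hle
  have hn : 0 < Complex.normSq (φ s) := Complex.normSq_pos.2 hφ0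
  by_contra! hneg
  nlinarith [mul_neg_of_pos_of_neg hn hneg]

open Metric in
lemma re_sub_re_eq_circleAverage {h : ℂ → ℂ} (hh : DiffContOnCl ℂ h (ball 0 1))
    {x : ℝ} (hx : |x| < 1) :
    (h x).re - (h 0).re
      = circleAverage (fun z => 2 * x * z.im * (h z).im / Complex.normSq (z - x)) 0 1 := by
  have hb : closure (ball (0:ℂ) 1) = closedBall 0 1 := closure_ball _ one_ne_zero
  have hx' : ((x:ℝ):ℂ) ∈ ball (0:ℂ) |1| := by simpa using hx
  have hhs : ContinuousOn h (sphere 0 1) :=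
    hh.continuousOn.mono (by rw [hb]; exact sphere_subset_closedBall)
  have hne : ∀ z : ℂ, ‖z‖ ≤ 1 → 1 - (x:ℂ) * z ≠ 0 := by
    intro z hz h0
    have : ‖(x:ℂ) * z‖ = 1 := by rw [← sub_eq_zero.1 h0]; simp
    rw [norm_mul, Complex.norm_real, Real.norm_eq_abs] at this
    nlinarith [abs_nonneg x, norm_nonneg z]
  have hne' : ∀ z ∈ sphere (0:ℂ) 1, z - x ≠ 0 := by
    intro z hz h0
    rw [sub_eq_zero.1 h0] at hz
    simp at hz
    linarith
  have h1 := DiffContOnCl.circleAverage_smul_div (R := 1) (c := 0) (by simpa using hh) hx'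
  have hd : DiffContOnCl ℂ (fun z => (1 - (x:ℂ) * z)⁻¹ * h z) (ball 0 1) := by
    refine DiffContOnCl.smul (DiffContOnCl.inv ?_ ?_) hh
    · exact (Differentiable.diffContOnCl (by fun_prop))
    · intro z hz
      rw [hb] at hz
      exact hne z (by simpa using hz)
  have h2 := DiffContOnCl.circleAverage (R := 1) (c := 0) (by simpa using hd)
  have i1 : CircleIntegrable (fun z => ((z - 0) / (z - (x:ℂ))) • h z) 0 1 := by
    refine ContinuousOn.circleIntegrable zero_le_one ?_
    exact ((continuousOn_id.sub continuousOn_const).div (by fun_prop) hne').smul hhs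
  have i2 : CircleIntegrable (fun z => (1 - (x:ℂ) * z)⁻¹ * h z) 0 1 := by
    refine ContinuousOn.circleIntegrable zero_le_one ?_
    exact hd.continuousOn.mono (by rw [hb]; exact sphere_subset_closedBall)
  have h3 := circleAverage_sub i1 i2
  rw [h1, h2] at h3
  have h4 := Complex.reCLM.circleAverage_comp_comm (i1.sub i2)
  rw [h3] at h4
  simp only [mul_zero, sub_zero, inv_one, one_mul, Complex.reCLM_apply, Complex.sub_re] at h4
  rw [← h4]
  refine circleAverage_congr_sphere fun z hz => ?_
  have hz1 : z ∈ sphere (0:ℂ) 1 := by simpa using hz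
  have hz2 : ‖z‖ = 1 := by simpa using hz1
  have hz3 : z.re * z.re + z.im * z.im = 1 := by
    rw [← Complex.normSq_apply, Complex.normSq_eq_norm_sq, hz2]; norm_num
  have hN := Complex.normSq_pos.2 (hne' z hz1)
  have e : z / (z - x) - (1 - (x:ℂ) * z)⁻¹
      = ((-(2 * x * z.im / Complex.normSq (z - x)) : ℝ) : ℂ) * Complex.I := by
    have hzz : z * (starRingEnd ℂ) z = 1 := by
      rw [Complex.mul_conj, Complex.normSq_eq_norm_sq, hz2]; norm_num
    have e1 : (1 - (x:ℂ) * z)⁻¹ = (starRingEnd ℂ z) / (starRingEnd ℂ (z - x)) := by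
      have : starRingEnd ℂ (z - x) ≠ 0 := (map_ne_zero _).2 (hne' z hz1)
      rw [inv_eq_one_div, div_eq_div_iff (hne z hz2.le) this]
      simp only [map_sub, Complex.conj_ofReal]
      linear_combination (x:ℂ) * hzz
    have e2 : starRingEnd ℂ z / starRingEnd ℂ (z - x) = starRingEnd ℂ (z / (z - x)) := by
      rw [map_div₀]
    rw [e1, e2, Complex.sub_conj]
    congr 2
    rw [Complex.div_im]
    simp
    field_simp
    ring
  simp only [Function.comp_apply, Pi.sub_apply, smul_eq_mul, Complex.reCLM_apply]
  rw [← sub_mul, e]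
  simp
  ring

lemma one_sub_sq_add_pos {x c : ℝ} (hx : |x| < 1) (hc0 : 0 ≤ c) (hc1 : c ≤ 1) :
    0 < (1 - x) ^ 2 + 4 * c * x := by
  obtain ⟨h1, h2⟩ := abs_lt.1 hx
  have e : (1 - x) ^ 2 + 4 * c * x = (1 - c) * (1 - x) ^ 2 + c * (1 + x) ^ 2 := by ring
  have p1 : 0 < (1 - x) ^ 2 := by have : 0 < 1 - x := by linarith
                                  positivity
  have p2 : 0 < (1 + x) ^ 2 := by have : 0 < 1 + x := by linarith
                                  positivity
  rw [e]
  rcases hc0.eq_or_lt with h | h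
  · subst h; simpa using p1
  · have := mul_pos h p2
    have := mul_nonneg (sub_nonneg.2 hc1) p1.le
    linarith

open Metric in
lemma exists_finiteMeasure_re_sub_re_of_diffContOnCl {h : ℂ → ℂ}
    (hh : DiffContOnCl ℂ h (ball 0 1)) (him : ∀ z ∈ sphere (0:ℂ) 1, 0 ≤ (h z).im * z.im) :
    ∃ ν : FiniteMeasure unitInterval, ∀ x : ℝ, |x| < 1 →
      (h x).re - (h 0).re = ∫ c, x / ((1 - x) ^ 2 + 4 * (c : ℝ) * x) ∂(ν : Measure unitInterval) := by
  have hb : closure (ball (0:ℂ) 1) = closedBall 0 1 := closure_ball _ one_ne_zero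
  have hz1 : ∀ θ, ‖circleMap 0 1 θ‖ = 1 := fun θ => by simp
  have hhs : Continuous (fun θ => h (circleMap 0 1 θ)) := by
    refine hh.continuousOn.comp_continuous (by fun_prop) fun θ => ?_
    rw [hb]; simp
  let w : ℝ → ℝ := fun θ => (2 * π)⁻¹ * (2 * ((h (circleMap 0 1 θ)).im * (circleMap 0 1 θ).im))
  have hwc : Continuous w := continuous_const.mul (continuous_const.mul
    ((Complex.continuous_im.comp hhs).mul
      (Complex.continuous_im.comp (continuous_circleMap 0 1))))
  have hw0 : ∀ θ, 0 ≤ w θ := fun θ => by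
    have := him (circleMap 0 1 θ) (by simp)
    positivity
  let c : ℝ → unitInterval := fun θ => ⟨(1 - (circleMap 0 1 θ).re) / 2, by
    have := abs_le.1 ((Complex.abs_re_le_norm (circleMap 0 1 θ)).trans_eq (hz1 θ))
    constructor <;> linarith⟩
  have hc : Continuous c := by
    refine Continuous.subtype_mk ?_ _
    fun_prop
  let μ : Measure ℝ := (volume.restrict (Set.Ioc 0 (2 * π))).withDensity fun θ => ENNReal.ofReal (w θ)
  have hμ : IsFiniteMeasure μ := by
    refine isFiniteMeasure_withDensity_ofReal ?_
    exact (hwc.integrableOn_Icc.mono_set Set.Ioc_subset_Icc_self).2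
  refine ⟨⟨μ.map c, inferInstance⟩, fun x hx => ?_⟩
  have h_integrable : Continuous fun c : unitInterval => x / ((1 - x) ^ 2 + 4 * (c : ℝ) * x) := by
    refine continuous_const.div (by fun_prop) fun c => (one_sub_sq_add_pos hx c.2.1 c.2.2).ne'
  rw [re_sub_re_eq_circleAverage hh hx, circleAverage_def]
  change _ = ∫ c, x / ((1 - x) ^ 2 + 4 * (c : ℝ) * x) ∂(μ.map c)
  rw [integral_map hc.aemeasurable h_integrable.aestronglyMeasurable,
    integral_withDensity_eq_integral_toReal_smul (by fun_prop) (by simp),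
    intervalIntegral.integral_of_le two_pi_pos.le, smul_eq_mul, ← integral_const_mul]
  refine integral_congr_ae (ae_of_all _ fun θ => ?_)
  simp only [smul_eq_mul, ENNReal.toReal_ofReal (hw0 θ), w, c]
  have e : Complex.normSq (circleMap 0 1 θ - x)
      = (1 - x) ^ 2 + 4 * ((1 - (circleMap 0 1 θ).re) / 2) * x := by
    have := hz1 θ
    have h3 : (circleMap 0 1 θ).re * (circleMap 0 1 θ).re
        + (circleMap 0 1 θ).im * (circleMap 0 1 θ).im = 1 := by
      rw [← Complex.normSq_apply, Complex.normSq_eq_norm_sq, this]; norm_num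
    rw [Complex.normSq_apply]
    simp only [Complex.sub_re, Complex.sub_im, Complex.ofReal_re, Complex.ofReal_im]
    linear_combination h3
  rw [e]
  ring

open Metric Filter Topology in
/-- Integral representation of typically real functions on the unit disc. -/
lemma exists_finiteMeasure_re_sub_re_of_differentiableOn {g : ℂ → ℂ}
    (hg : DifferentiableOn ℂ g (ball 0 1)) (him : ∀ z ∈ ball (0:ℂ) 1, 0 ≤ (g z).im * z.im) :
    ∃ ν : FiniteMeasure unitInterval, ∀ x : ℝ, |x| < 1 →
      (g x).re - (g 0).re = ∫ c, x / ((1 - x) ^ 2 + 4 * (c : ℝ) * x) ∂(ν : Measure unitInterval) := by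
  let r : ℕ → ℝ := fun n => 1 - 1 / (((n + 1 : ℕ) : ℝ) + 1)
  have hr0 : ∀ n, 0 < r n := fun n => by
    have : 1 / (((n + 1 : ℕ) : ℝ) + 1) < 1 := by
      rw [div_lt_one (by positivity)]; push_cast; linarith [n.cast_nonneg (α := ℝ)]
    simp only [r]; linarith
  have hr1 : ∀ n, r n < 1 := fun n => by
    have : 0 < 1 / (((n + 1 : ℕ) : ℝ) + 1) := by positivity
    simp only [r]; linarith
  have hr : Tendsto r atTop (𝓝 1) := by
    have h := (tendsto_one_div_add_atTop_nhds_zero_nat (𝕜 := ℝ)).comp (tendsto_add_atTop_nat 1)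
    simpa [r] using! h.const_sub 1
  have hmem : ∀ n, ∀ z : ℂ, ‖z‖ ≤ 1 → (r n : ℂ) * z ∈ ball (0:ℂ) 1 := fun n z hz => by
    rw [mem_ball_zero_iff, norm_mul, Complex.norm_real, Real.norm_of_nonneg (hr0 n).le]
    nlinarith [hr0 n, hr1 n, norm_nonneg z]
  have H : ∀ n, ∃ ν : FiniteMeasure unitInterval, ∀ x : ℝ, |x| < 1 →
      (g (r n * x)).re - (g 0).re
        = ∫ c, x / ((1 - x) ^ 2 + 4 * (c : ℝ) * x) ∂(ν : Measure unitInterval) := by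
    intro n
    obtain ⟨ν, hν⟩ := exists_finiteMeasure_re_sub_re_of_diffContOnCl (h := fun z => g (r n * z))
      (DifferentiableOn.diffContOnCl (by
        rw [closure_ball _ one_ne_zero]
        exact hg.comp (by fun_prop) fun z hz => hmem n z (by simpa using hz)))
      (fun z hz => by
        have hz : ‖z‖ = 1 := by simpa using hz
        have h1 := him _ (hmem n z hz.le)
        rw [Complex.im_ofReal_mul, mul_left_comm] at h1
        exact nonneg_of_mul_nonneg_right h1 (hr0 n))
    exact ⟨ν, fun x hx => by simpa using hν x hx⟩
  choose ν hν using H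
  have hcont : ∀ x : ℝ, |x| < 1 →
      Continuous fun c : unitInterval => x / ((1 - x) ^ 2 + 4 * (c : ℝ) * x) := fun x hx =>
    continuous_const.div (by fun_prop) fun c => (one_sub_sq_add_pos hx c.2.1 c.2.2).ne'
  obtain ⟨C, hC⟩ := (isCompact_closedBall (0:ℂ) (1/2)).exists_bound_of_continuousOn
    (hg.continuousOn.mono (closedBall_subset_ball (by norm_num)))
  have hmass : ∀ n, (ν n).mass ≤ (9 / 2 * (2 * C)).toNNReal := by
    intro n
    have h1 := hν n (1/2) (by norm_num [abs_of_pos])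
    have h2 : (2 / 9 : ℝ) * (ν n).mass
        ≤ ∫ c, (1/2 : ℝ) / ((1 - 1/2) ^ 2 + 4 * (c : ℝ) * (1/2)) ∂(ν n : Measure unitInterval) := by
      have : (2 / 9 : ℝ) * (ν n).mass = ∫ c, (2/9 : ℝ) ∂(ν n : Measure unitInterval) := by
        rw [integral_const, smul_eq_mul, mul_comm]; rfl
      rw [this]
      refine integral_mono (integrable_const _)
        ((hcont (1/2) (by norm_num [abs_of_pos])).integrable_of_hasCompactSupport
          (HasCompactSupport.of_compactSpace _)) fun c => ?_
      have hc0 := c.2.1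
      have hc1 := c.2.2
      rw [div_le_div_iff₀ (by norm_num) (by positivity)]
      linarith
    rw [← h1] at h2
    have h3 := hC (r n * ((1/2 : ℝ) : ℂ)) (by
      rw [mem_closedBall_zero_iff, norm_mul, Complex.norm_real, Complex.norm_real,
        Real.norm_of_nonneg (hr0 n).le, Real.norm_of_nonneg (by norm_num)]
      linarith [hr1 n])
    have h4 := hC 0 (by simp)
    have h5 := (Complex.re_le_norm _).trans h3
    have h6 := (Complex.abs_re_le_norm _).trans h4
    rw [abs_le] at h6
    refine NNReal.coe_le_coe.1 (le_trans ?_ (Real.le_coe_toNNReal _))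
    linarith
  obtain ⟨ρ, -, hρ⟩ := (isCompact_setOfPred_finiteMeasure_le_of_compactSpace unitInterval
    (9 / 2 * (2 * C)).toNNReal).exists_mapClusterPt (f := atTop) (u := ν)
      (Filter.le_principal_iff.2 (Filter.mem_map.2 (Filter.univ_mem' hmass)))
  obtain ⟨U, hU, hlim⟩ := mapClusterPt_iff_ultrafilter.1 hρ
  refine ⟨ρ, fun x hx => ?_⟩
  have h1 := FiniteMeasure.tendsto_iff_forall_integral_tendsto.1 hlim
    (BoundedContinuousFunction.mkOfCompact ⟨_, hcont x hx⟩)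
  simp only [BoundedContinuousFunction.mkOfCompact_apply, ContinuousMap.coe_mk] at h1
  refine tendsto_nhds_unique (Tendsto.congr (fun n => hν n x hx) ?_) h1
  have h2 : Tendsto (fun n => (r n : ℂ) * x) U (𝓝 x) := by
    have := (((Complex.continuous_ofReal.tendsto 1).comp hr).mul_const (x:ℂ)).mono_left hU
    simpa using! this
  have h3 : ContinuousAt g x := (hg.differentiableAt (isOpen_ball.mem_nhds (by simpa using hx))).continuousAt
  exact ((Complex.continuous_re.tendsto _).comp (h3.tendsto.comp h2)).sub_const _

lemma one_add_mul_sub_one_pos {s c : ℝ} (hs : 0 < s) (hc0 : 0 ≤ c) (hc1 : c ≤ 1) :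
    0 < 1 + c * (s - 1) := by
  rcases hc0.eq_or_lt with h | h
  · simp [← h]
  · have := mul_pos h hs
    linarith

open Metric in
lemma exists_pos_cayley_sq_im {z : ℂ} (hz : z ∈ ball (0:ℂ) 1) :
    ((1 + z) / (1 - z)) ^ 2 ∈ Complex.slitPlane ∧
      ∃ a : ℝ, 0 < a ∧ (((1 + z) / (1 - z)) ^ 2).im = a * z.im := by
  have hz1 : ‖z‖ < 1 := by simpa using hz
  have hne : 1 - z ≠ 0 := by
    intro h
    rw [← sub_eq_zero.1 h] at hz1
    simp at hz1
  have hN := Complex.normSq_pos.2 hne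
  have hzn : z.re * z.re + z.im * z.im < 1 := by
    rw [← Complex.normSq_apply, Complex.normSq_eq_norm_sq]
    nlinarith [norm_nonneg z]
  set p := (1 + z) / (1 - z) with hp
  have hre : p.re = (1 - (z.re * z.re + z.im * z.im)) / Complex.normSq (1 - z) := by
    rw [hp, Complex.div_re]
    simp
    field_simp
    ring
  have him : p.im = 2 / Complex.normSq (1 - z) * z.im := by
    rw [hp, Complex.div_im]
    simp
    field_simp
    ring
  have hre0 : 0 < p.re := by rw [hre]; exact div_pos (by linarith) hN
  have hsq : (p ^ 2).im = 2 * p.re * p.im := by rw [sq, Complex.mul_im]; ring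
  refine ⟨?_, 2 * p.re * (2 / Complex.normSq (1 - z)), by positivity, by rw [hsq, him]; ring⟩
  rw [Complex.mem_slitPlane_iff]
  by_cases h : p.im = 0
  · left
    rw [sq, Complex.mul_re, h]
    nlinarith
  · right
    rw [hsq]
    positivity

open Metric in
/-- Integral representation of functions on the slit plane preserving the sign of the imaginary
part. -/
lemma exists_finiteMeasure_of_im_mul_im_nonneg {N : ℂ → ℂ}
    (hN : DifferentiableOn ℂ N Complex.slitPlane)
    (him : ∀ s ∈ Complex.slitPlane, 0 ≤ (N s).im * s.im) :
    ∃ ν : Measure unitInterval, IsFiniteMeasure ν ∧ ∀ s : ℝ, 0 < s →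
      (N s).re - (N 1).re = ∫ c, (s - 1) / (1 + (c : ℝ) * (s - 1)) ∂ν := by
  obtain ⟨ν, hν⟩ := exists_finiteMeasure_re_sub_re_of_differentiableOn
    (g := fun z => N (((1 + z) / (1 - z)) ^ 2))
    (hN.comp (DifferentiableOn.pow (DifferentiableOn.div (by fun_prop) (by fun_prop) fun z hz h => by
      have hz1 : ‖z‖ < 1 := by simpa using hz
      rw [← sub_eq_zero.1 h] at hz1
      simp at hz1) 2) fun z hz => (exists_pos_cayley_sq_im hz).1)
    (fun z hz => by
      obtain ⟨h1, a, ha, h2⟩ := exists_pos_cayley_sq_im hz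
      have h3 := him _ h1
      rw [h2, mul_left_comm] at h3
      exact nonneg_of_mul_nonneg_right h3 ha)
  refine ⟨ENNReal.ofReal (1 / 4) • (ν : Measure unitInterval), ?_, fun s hs => ?_⟩
  · exact Measure.smul_finite _ ENNReal.ofReal_ne_top
  have hq : 0 < √s := Real.sqrt_pos.2 hs
  have hqs : √s ^ 2 = s := Real.sq_sqrt hs.le
  set q := √s with hqdef
  have hx : |(q - 1) / (q + 1)| < 1 := by
    rw [abs_div, abs_of_pos (by positivity : 0 < q + 1), div_lt_one (by positivity), abs_lt]
    constructor <;> linarith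
  have h := hν _ hx
  have e : ((1 + (((q - 1) / (q + 1) : ℝ) : ℂ)) / (1 - (((q - 1) / (q + 1) : ℝ) : ℂ))) ^ 2 = s := by
    rw [← hqs]
    norm_cast
    have : 1 - (q - 1) / (q + 1) = 2 / (q + 1) := by field_simp; ring
    rw [this]
    field_simp
    ring
  simp only [e, add_zero, sub_zero, div_one, one_pow] at h
  rw [h, integral_smul_measure, ENNReal.toReal_ofReal (by norm_num), ← integral_smul]
  refine integral_congr_ae (ae_of_all _ fun c => ?_)
  have hd := one_add_mul_sub_one_pos hs c.2.1 c.2.2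
  simp only [smul_eq_mul]
  have e1 : (1 - (q - 1) / (q + 1)) ^ 2 + 4 * (c:ℝ) * ((q - 1) / (q + 1))
      = 4 * (1 + (c:ℝ) * (s - 1)) / (q + 1) ^ 2 := by
    rw [← hqs]; field_simp; ring
  rw [e1, ← hqs]
  rw [← hqs] at hd
  field_simp
  ring

open Set Filter Topology in
lemma tendsto_zero_of_monotoneOn_of_hasDerivAt {L n : ℝ → ℝ}
    (hL : Tendsto L (𝓝[>] 0) (𝓝 0)) (hd : ∀ s, 0 < s → HasDerivAt L (n s / s) s)
    (hn : MonotoneOn n (Ioi 0)) : Tendsto n (𝓝[>] 0) (𝓝 0) := by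
  have key : ∀ e, 0 < e → ∃ x ∈ Ioo e (2 * e), |n x| ≤ 2 * |L (2 * e) - L e| := by
    intro e he
    obtain ⟨x, hx, h⟩ := exists_hasDerivAt_eq_slope L (fun s => n s / s) (by linarith : e < 2 * e)
      (fun x hx => (hd x (by linarith [hx.1])).continuousAt.continuousWithinAt)
      (fun x hx => hd x (he.trans hx.1))
    refine ⟨x, hx, ?_⟩
    have hx0 : 0 < x := he.trans hx.1
    have e1 : n x = x / e * (L (2 * e) - L e) := by
      have : 2 * e - e = e := by ring
      rw [this, div_eq_div_iff hx0.ne' he.ne'] at h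
      rw [div_mul_eq_mul_div, eq_div_iff he.ne']
      linear_combination h
    rw [e1, abs_mul, abs_of_pos (by positivity)]
    gcongr
    rw [div_le_iff₀ he]
    exact hx.2.le
  have hscale : ∀ a : ℝ, 0 < a → Tendsto (fun e => L (a * e)) (𝓝[>] 0) (𝓝 0) := by
    intro a ha
    refine hL.comp (tendsto_nhdsWithin_of_tendsto_nhds_of_eventually_within _ ?_ ?_)
    · have : Tendsto (fun e : ℝ => a * e) (𝓝 0) (𝓝 (a * 0)) := tendsto_id.const_mul a
      rw [mul_zero] at this
      exact this.mono_left nhdsWithin_le_nhds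
    · filter_upwards [self_mem_nhdsWithin] with e he using mul_pos ha he
  have hup : Tendsto (fun e => 2 * |L (2 * e) - L e|) (𝓝[>] 0) (𝓝 0) := by
    simpa using (((hscale 2 two_pos).sub hL).abs.const_mul 2)
  have hlo : Tendsto (fun e => -(2 * |L e - L (2⁻¹ * e)|)) (𝓝[>] 0) (𝓝 0) := by
    simpa using (((hL.sub (hscale 2⁻¹ (by norm_num))).abs.const_mul 2).neg)
  refine tendsto_of_tendsto_of_tendsto_of_le_of_le' hlo hup ?_ ?_
  · filter_upwards [self_mem_nhdsWithin] with e (he : 0 < e)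
    obtain ⟨x, hx, h⟩ := key (2⁻¹ * e) (by positivity)
    have h2 : 2 * (2⁻¹ * e) = e := by ring
    rw [h2] at hx h
    have := hn (show x ∈ Ioi (0:ℝ) from lt_trans (by positivity) hx.1) he hx.2.le
    linarith [(abs_le.1 h).1]
  · filter_upwards [self_mem_nhdsWithin] with e (he : 0 < e)
    obtain ⟨x, hx, h⟩ := key e he
    have := hn he (show x ∈ Ioi (0:ℝ) from he.trans hx.1) hx.1.le
    linarith [(abs_le.1 h).2]

lemma integrable_div_one_add_mul {s : ℝ} (hs : 0 < s) (ν : Measure unitInterval)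
    [IsFiniteMeasure ν] : Integrable (fun c : unitInterval => (s - 1) / (1 + (c : ℝ) * (s - 1))) ν := by
  have : Continuous fun c : unitInterval => (s - 1) / (1 + (c : ℝ) * (s - 1)) :=
    continuous_const.div (by fun_prop) fun c => (one_add_mul_sub_one_pos hs c.2.1 c.2.2).ne'
  exact this.integrable_of_hasCompactSupport (HasCompactSupport.of_compactSpace _)

lemma monotoneOn_of_integral_representation {n : ℝ → ℝ} {ν : Measure unitInterval}
    [IsFiniteMeasure ν]
    (hn : ∀ s, 0 < s → n s - n 1 = ∫ c, (s - 1) / (1 + (c : ℝ) * (s - 1)) ∂ν) :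
    MonotoneOn n (Set.Ioi 0) := by
  intro s hs u hu hsu
  have : n s - n 1 ≤ n u - n 1 := by
    rw [hn s hs, hn u hu]
    refine integral_mono (integrable_div_one_add_mul hs ν) (integrable_div_one_add_mul hu ν) fun c => ?_
    rw [div_le_div_iff₀ (one_add_mul_sub_one_pos hs c.2.1 c.2.2)
      (one_add_mul_sub_one_pos hu c.2.1 c.2.2)]
    linarith
  linarith

open Set Filter Topology in
lemma lintegral_inv_one_sub_eq {n : ℝ → ℝ} {ν : Measure unitInterval} [IsFiniteMeasure ν]
    (hn : ∀ s, 0 < s → n s - n 1 = ∫ c, (s - 1) / (1 + (c : ℝ) * (s - 1)) ∂ν)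
    (h0 : Tendsto n (𝓝[>] 0) (𝓝 0)) :
    ∫⁻ c, (ENNReal.ofReal (1 - (c : ℝ)))⁻¹ ∂ν = ENNReal.ofReal (n 1) := by
  let b : ℕ → ℝ := fun j => 1 + 1 / ((j : ℝ) + 1)
  have hb1 : ∀ j, 1 < b j := fun j => by
    have : 0 < 1 / ((j : ℝ) + 1) := by positivity
    simp only [b]; linarith
  have hb : Tendsto b atTop (𝓝 1) := by
    simpa [b] using! (tendsto_one_div_add_atTop_nhds_zero_nat (𝕜 := ℝ)).const_add 1
  have hbm : Antitone b := fun i j hij => by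
    simp only [b]; gcongr
  have hs0 : ∀ j, 0 < 1 - (b j)⁻¹ := fun j => by
    have := inv_lt_one_of_one_lt₀ (hb1 j); linarith
  have e1 : ∀ j, ∫⁻ c : unitInterval, (ENNReal.ofReal (b j - (c : ℝ)))⁻¹ ∂ν
      = ENNReal.ofReal (n 1 - n (1 - (b j)⁻¹)) := by
    intro j
    have hj := hb1 j
    have h1 := hn _ (hs0 j)
    have h2 : n 1 - n (1 - (b j)⁻¹) = ∫ c : unitInterval, (b j - (c:ℝ))⁻¹ ∂ν := by
      rw [← neg_sub, h1, ← integral_neg]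
      refine integral_congr_ae (ae_of_all _ fun c => ?_)
      have hc : 0 < b j - c := by linarith [c.2.2]
      have hc' : 0 < 1 + (c:ℝ) * (1 - (b j)⁻¹ - 1) := one_add_mul_sub_one_pos (hs0 j) c.2.1 c.2.2
      simp only
      rw [neg_div', ← one_div (b j - (c:ℝ)), div_eq_div_iff hc'.ne' hc.ne']
      field_simp
      ring
    rw [h2, ofReal_integral_eq_lintegral_ofReal]
    · refine lintegral_congr fun c => ?_
      rw [ENNReal.ofReal_inv_of_pos (by linarith [c.2.2])]
    · have : Continuous fun c : unitInterval => (b j - (c:ℝ))⁻¹ :=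
        Continuous.inv₀ (by fun_prop) fun c => by have := c.2.2; linarith
      exact this.integrable_of_hasCompactSupport (HasCompactSupport.of_compactSpace _)
    · exact ae_of_all _ fun c => inv_nonneg.2 (by linarith [c.2.2])
  have h1 : Tendsto (fun j => ∫⁻ c : unitInterval, (ENNReal.ofReal (b j - (c : ℝ)))⁻¹ ∂ν) atTop
      (𝓝 (∫⁻ c : unitInterval, (ENNReal.ofReal (1 - (c : ℝ)))⁻¹ ∂ν)) := by
    refine lintegral_tendsto_of_tendsto_of_monotone (fun j => Measurable.aemeasurable (by fun_prop))
      (ae_of_all _ fun c i j hij => ?_) (ae_of_all _ fun c => ?_)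
    · simp only
      gcongr
      exact hbm hij
    · exact ((ENNReal.continuous_ofReal.tendsto _).comp (hb.sub_const _)).inv
  have h2 : Tendsto (fun j => 1 - (b j)⁻¹) atTop (𝓝[>] 0) := by
    refine tendsto_nhdsWithin_of_tendsto_nhds_of_eventually_within _ ?_ (Eventually.of_forall hs0)
    simpa using (hb.inv₀ one_ne_zero).const_sub 1
  simp only [e1] at h1
  refine tendsto_nhds_unique h1 ?_
  have := (ENNReal.continuous_ofReal.tendsto _).comp ((h0.comp h2).const_sub (n 1))
  simpa using! this

lemma ae_lt_one_of_lintegral_inv_one_sub {ν : Measure unitInterval}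
    (h : ∫⁻ c, (ENNReal.ofReal (1 - (c : ℝ)))⁻¹ ∂ν ≠ ⊤) : ∀ᵐ c : unitInterval ∂ν, (c : ℝ) < 1 := by
  filter_upwards [ae_lt_top (by fun_prop) h] with c hc
  by_contra h1
  rw [ENNReal.ofReal_of_nonpos (by linarith)] at hc
  simp at hc

lemma ofReal_div_eq_lintegral {n : ℝ → ℝ} {ν : Measure unitInterval} [IsFiniteMeasure ν]
    (hn : ∀ s, 0 < s → n s - n 1 = ∫ c, (s - 1) / (1 + (c : ℝ) * (s - 1)) ∂ν)
    (h1 : ∫⁻ c, (ENNReal.ofReal (1 - (c : ℝ)))⁻¹ ∂ν = ENNReal.ofReal (n 1)) (hn1 : 0 ≤ n 1)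
    {s : ℝ} (hs : 0 < s) :
    ENNReal.ofReal (n s / s)
      = ∫⁻ c, ENNReal.ofReal ((1 - (c : ℝ))⁻¹ * (1 + c * (s - 1))⁻¹) ∂ν := by
  have hlt := ae_lt_one_of_lintegral_inv_one_sub (ν := ν) (by rw [h1]; exact ENNReal.ofReal_ne_top)
  have e1 : ∫⁻ c : unitInterval, ENNReal.ofReal ((1 - (c : ℝ))⁻¹) ∂ν = ENNReal.ofReal (n 1) := by
    rw [← h1]
    refine lintegral_congr_ae ?_
    filter_upwards [hlt] with c hc
    rw [ENNReal.ofReal_inv_of_pos (by linarith)]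
  have hnn : ∀ c : unitInterval, 0 ≤ (1 - (c : ℝ))⁻¹ := fun c => inv_nonneg.2 (by linarith [c.2.2])
  have hm : Measurable fun c : unitInterval => (1 - (c : ℝ))⁻¹ := by fun_prop
  have i1 : Integrable (fun c : unitInterval => (1 - (c : ℝ))⁻¹) ν := by
    refine ⟨hm.aestronglyMeasurable, ?_⟩
    rw [hasFiniteIntegral_iff_ofReal (ae_of_all _ hnn), e1]
    exact ENNReal.ofReal_lt_top
  have e2 : n 1 = ∫ c : unitInterval, (1 - (c : ℝ))⁻¹ ∂ν := by
    rw [integral_eq_lintegral_of_nonneg_ae (ae_of_all _ hnn) hm.aestronglyMeasurable, e1,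
      ENNReal.toReal_ofReal hn1]
  have i2 := integrable_div_one_add_mul hs ν
  have e3 : n s = ∫ c : unitInterval, ((1 - (c : ℝ))⁻¹ + (s - 1) / (1 + (c : ℝ) * (s - 1))) ∂ν := by
    rw [integral_add i1 i2, ← e2, ← hn s hs]
    ring
  have e4 : (fun c : unitInterval => ((1 - (c : ℝ))⁻¹ + (s - 1) / (1 + (c : ℝ) * (s - 1))) / s)
      =ᵐ[ν] fun c => (1 - (c : ℝ))⁻¹ * (1 + c * (s - 1))⁻¹ := by
    filter_upwards [hlt] with c hc
    have hc1 : 1 - (c:ℝ) ≠ 0 := by linarith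
    have hc2 := (one_add_mul_sub_one_pos hs c.2.1 c.2.2).ne'
    field_simp
    ring
  rw [e3, ← integral_div, integral_congr_ae e4, ofReal_integral_eq_lintegral_ofReal]
  · exact ((i1.add i2).div_const s).congr e4
  · exact ae_of_all _ fun c => mul_nonneg (hnn c)
      (inv_nonneg.2 (one_add_mul_sub_one_pos hs c.2.1 c.2.2).le)

open Set in
lemma lintegral_Ioc_inv_one_add_mul {c s : ℝ} (hc0 : 0 < c) (hc1 : c < 1) (hs : 0 ≤ s) :
    ∫⁻ u in Ioc 0 s, ENNReal.ofReal ((1 - c)⁻¹ * (1 + c * (u - 1))⁻¹)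
      = ENNReal.ofReal (((1 - c) * c)⁻¹) * ENNReal.ofReal (log (((1 - c) / c + s) / ((1 - c) / c))) := by
  have hd : ∀ u ∈ uIcc 0 s, HasDerivAt (fun u => ((1 - c) * c)⁻¹ * log (1 + c * (u - 1)))
      ((1 - c)⁻¹ * (1 + c * (u - 1))⁻¹) u := by
    intro u hu
    rw [uIcc_of_le hs] at hu
    have hp : 0 < 1 + c * (u - 1) := by nlinarith [hu.1]
    have h1 : HasDerivAt (fun u : ℝ => 1 + c * (u - 1)) c u := by
      simpa using (((hasDerivAt_id u).sub_const 1).const_mul c).const_add 1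
    have e : (1 - c)⁻¹ * (1 + c * (u - 1))⁻¹ = ((1 - c) * c)⁻¹ * (c / (1 + c * (u - 1))) := by
      rw [mul_inv, mul_assoc, mul_div_left_comm, ← mul_assoc, ← div_eq_inv_mul]
      field_simp
    rw [e]
    exact (h1.log hp.ne').const_mul ((1 - c) * c)⁻¹
  have hcont : ContinuousOn (fun u => (1 - c)⁻¹ * (1 + c * (u - 1))⁻¹) (Icc 0 s) := by
    refine continuousOn_const.mul (ContinuousOn.inv₀ (by fun_prop) fun u hu => ?_)
    have hp : 0 < 1 + c * (u - 1) := by nlinarith [hu.1]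
    exact hp.ne'
  have hii : IntervalIntegrable (fun u => (1 - c)⁻¹ * (1 + c * (u - 1))⁻¹) volume 0 s :=
    ContinuousOn.intervalIntegrable_of_Icc hs hcont
  have h := intervalIntegral.integral_eq_sub_of_hasDerivAt hd hii
  rw [intervalIntegral.integral_of_le hs] at h
  have h1c : 0 < 1 - c := by linarith
  rw [← ofReal_integral_eq_lintegral_ofReal ((intervalIntegrable_iff_integrableOn_Ioc_of_le hs).1 hii),
    h, ← ENNReal.ofReal_mul (by positivity), ← mul_sub, ← Real.log_div]
  · congr 3
    have h2 : 1 + c * (0 - 1) = 1 - c := by ring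
    rw [h2]
    field_simp
    ring
  · have : 0 < 1 + c * (s - 1) := by nlinarith
    exact this.ne'
  · linarith
  · refine (ae_restrict_iff' measurableSet_Ioc).2 (ae_of_all _ fun u hu => ?_)
    have hp : 0 < 1 + c * (u - 1) := by nlinarith [hu.1]
    simp only [Pi.zero_apply]
    positivity

open Set in
lemma exists_measure_lintegral_eq (ν : Measure unitInterval) :
    ∃ U : Measure ℝ, U (Iic 0) = 0 ∧ ∀ h : ℝ → ENNReal, Measurable h →
      ∫⁻ t, h t ∂U = ∫⁻ c in {c : unitInterval | 0 < (c:ℝ) ∧ (c:ℝ) < 1},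
        ENNReal.ofReal (((1 - (c:ℝ)) * c)⁻¹) * h ((1 - (c:ℝ)) / c) ∂ν := by
  have hS : MeasurableSet {c : unitInterval | 0 < (c:ℝ) ∧ (c:ℝ) < 1} :=
    (measurableSet_lt measurable_const measurable_subtype_coe).inter
      (measurableSet_lt measurable_subtype_coe measurable_const)
  have hT : Measurable fun c : unitInterval => (1 - (c:ℝ)) / c := by fun_prop
  have key : ∀ h : ℝ → ENNReal, Measurable h →
      ∫⁻ t, h t ∂(((ν.restrict {c : unitInterval | 0 < (c:ℝ) ∧ (c:ℝ) < 1}).withDensity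
        fun c => ENNReal.ofReal (((1 - (c:ℝ)) * c)⁻¹)).map fun c : unitInterval => (1 - (c:ℝ)) / c)
      = ∫⁻ c in {c : unitInterval | 0 < (c:ℝ) ∧ (c:ℝ) < 1},
        ENNReal.ofReal (((1 - (c:ℝ)) * c)⁻¹) * h ((1 - (c:ℝ)) / c) ∂ν := by
    intro h hh
    rw [lintegral_map hh hT]
    exact lintegral_withDensity_eq_lintegral_mul _ (by fun_prop) (hh.comp hT)
  refine ⟨_, ?_, key⟩
  rw [← lintegral_indicator_one measurableSet_Iic, key _ (measurable_one.indicator measurableSet_Iic),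
    setLIntegral_congr_fun (g := fun _ => 0) hS fun c hc => ?_]
  · simp
  have : (1 - (c:ℝ)) / c ∉ Iic (0:ℝ) := by
    have := div_pos (sub_pos.2 hc.2) hc.1
    simpa using! this
  rw [indicator_of_notMem this, mul_zero]

open Set Filter Topology in
/-- Thorin representation in integrated form. -/
lemma exists_thorin_measure {L n : ℝ → ℝ} {ν : Measure unitInterval} [IsFiniteMeasure ν]
    (hLc : ContinuousOn L (Ici 0)) (hL0 : L 0 = 0) (hd : ∀ s, 0 < s → HasDerivAt L (n s / s) s)
    (hn : ∀ s, 0 < s → n s - n 1 = ∫ c, (s - 1) / (1 + (c : ℝ) * (s - 1)) ∂ν) :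
    ∃ (a : ℝ) (U : Measure ℝ), 0 ≤ a ∧ U (Iic 0) = 0 ∧ ∀ s, 0 ≤ s → 0 ≤ L s ∧
      ENNReal.ofReal (L s)
        = ENNReal.ofReal (a * s) + ∫⁻ t, ENNReal.ofReal (log ((t + s) / t)) ∂U := by
  have hmono := monotoneOn_of_integral_representation hn
  have hL : Tendsto L (𝓝[>] 0) (𝓝 0) := by
    have := (hLc 0 self_mem_Ici).mono Ioi_subset_Ici_self
    rwa [ContinuousWithinAt, hL0] at this
  have h0 := tendsto_zero_of_monotoneOn_of_hasDerivAt hL hd hmono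
  have hn0 : ∀ s, 0 < s → 0 ≤ n s := fun s hs => by
    refine le_of_tendsto h0 ?_
    filter_upwards [Ioo_mem_nhdsGT hs] with u hu using hmono hu.1 hs hu.2.le
  have h1 := lintegral_inv_one_sub_eq hn h0
  have hlt := ae_lt_one_of_lintegral_inv_one_sub (ν := ν) (by rw [h1]; exact ENNReal.ofReal_ne_top)
  obtain ⟨U, hU0, hU⟩ := exists_measure_lintegral_eq ν
  refine ⟨ν.real {0}, U, measureReal_nonneg, hU0, fun s hs => ?_⟩
  have hnn : ∀ u ∈ Ioo 0 s, 0 ≤ n u / u := fun u hu => div_nonneg (hn0 u hu.1) hu.1.le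
  have hLcs : ContinuousOn L (Icc 0 s) := hLc.mono Icc_subset_Ici_self
  have h_integrable : IntegrableOn (fun u => n u / u) (Ioc 0 s) :=
    intervalIntegral.integrableOn_deriv_of_nonneg hLcs (fun u hu => hd u hu.1) hnn
  have hF := intervalIntegral.integral_eq_sub_of_hasDerivAt_of_le hs hLcs (fun u hu => hd u hu.1)
    ((intervalIntegrable_iff_integrableOn_Ioc_of_le hs).2 h_integrable)
  rw [hL0, sub_zero, intervalIntegral.integral_of_le hs] at hF
  have hnn' : 0 ≤ᵐ[volume.restrict (Ioc 0 s)] fun u => n u / u :=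
    (ae_restrict_iff' measurableSet_Ioc).2 (ae_of_all _ fun u hu =>
      div_nonneg (hn0 u hu.1) hu.1.le)
  refine ⟨hF ▸ integral_nonneg_of_ae hnn', ?_⟩
  rw [← hF, ofReal_integral_eq_lintegral_ofReal h_integrable hnn',
    setLIntegral_congr_fun measurableSet_Ioc
      (fun u hu => ofReal_div_eq_lintegral hn h1 (hn0 1 one_pos) hu.1),
    lintegral_lintegral_swap (Measurable.aemeasurable (by fun_prop)), hU _ (by fun_prop)]
  have hS : MeasurableSet {c : unitInterval | 0 < (c:ℝ) ∧ (c:ℝ) < 1} :=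
    (measurableSet_lt measurable_const measurable_subtype_coe).inter
      (measurableSet_lt measurable_subtype_coe measurable_const)
  have h0S : (({0} ∪ {c : unitInterval | 0 < (c:ℝ) ∧ (c:ℝ) < 1} : Set unitInterval)) =ᵐ[ν] univ := by
    refine eventuallyEq_univ.2 ?_
    filter_upwards [hlt] with c hc
    rcases c.2.1.eq_or_lt with h | h
    · left; exact Subtype.ext h.symm
    · right; exact ⟨h, hc⟩
  rw [← setLIntegral_univ, ← setLIntegral_congr h0S, lintegral_union hS (by
    rw [disjoint_singleton_left]; rintro ⟨h, -⟩; simp at h)]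
  congr 1
  · rw [lintegral_singleton]
    rw [mul_comm, ENNReal.ofReal_mul measureReal_nonneg, measureReal_def,
      ENNReal.ofReal_toReal (measure_ne_top _ _)]
    simp
  · exact setLIntegral_congr_fun hS fun c hc => lintegral_Ioc_inv_one_add_mul hc.1 hc.2 hs

open Set in
lemma thorin_measure_conditions {U : Measure ℝ}
    (hU : ∫⁻ t, ENNReal.ofReal (log ((t + 1) / t)) ∂U ≠ ⊤) :
    (∀ r s : ℝ, 0 < r → U (Icc r s) < ⊤) ∧
    (∫⁻ t in Ioc (0:ℝ) 1, ENNReal.ofReal |log t| ∂U) < ⊤ ∧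
    (∫⁻ t in Ici (1:ℝ), ENNReal.ofReal t⁻¹ ∂U) < ⊤ := by
  refine ⟨fun r s hr => ?_, ?_, ?_⟩
  · rcases lt_or_ge s r with h | h
    · simp [h]
    have hs : 0 < s := hr.trans_le h
    have hlog : 0 < log ((s + 1) / s) := log_pos (by rw [one_lt_div hs]; linarith)
    refine lt_of_le_of_lt ?_ (ENNReal.div_lt_top hU (ENNReal.ofReal_pos.2 hlog).ne')
    refine (measure_mono fun t ht => ?_).trans
      (meas_ge_le_lintegral_div (by fun_prop) (ENNReal.ofReal_pos.2 hlog).ne' ENNReal.ofReal_ne_top)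
    have ht0 : 0 < t := hr.trans_le ht.1
    refine ENNReal.ofReal_le_ofReal (log_le_log (by positivity) ?_)
    rw [div_le_div_iff₀ hs ht0]
    linarith [ht.2]
  · refine lt_of_le_of_lt ?_ hU.lt_top
    refine le_trans ?_ (setLIntegral_le_lintegral (Ioc 0 1) _)
    refine setLIntegral_mono (by fun_prop) fun t ht => ENNReal.ofReal_le_ofReal ?_
    rw [abs_of_nonpos (log_nonpos ht.1.le ht.2), ← log_inv]
    refine log_le_log (inv_pos.2 ht.1) ?_
    rw [inv_eq_one_div]
    have := ht.1
    gcongr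
    linarith
  · have h2 : ∫⁻ t, ENNReal.ofReal 2 * ENNReal.ofReal (log ((t + 1) / t)) ∂U < ⊤ := by
      rw [lintegral_const_mul _ (by fun_prop)]
      exact ENNReal.mul_lt_top ENNReal.ofReal_lt_top hU.lt_top
    refine lt_of_le_of_lt ?_ h2
    refine le_trans ?_ (setLIntegral_le_lintegral (Ici 1) _)
    refine setLIntegral_mono (by fun_prop) fun t (ht : 1 ≤ t) => ?_
    rw [← ENNReal.ofReal_mul zero_le_two]
    refine ENNReal.ofReal_le_ofReal ?_
    have ht0 : 0 < t := by linarith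
    have h3 := one_sub_inv_le_log_of_pos (show 0 < (t + 1) / t by positivity)
    have h4 : 1 - ((t + 1) / t)⁻¹ = 1 / (t + 1) := by field_simp; ring
    have h5 : t⁻¹ ≤ 2 * (1 / (t + 1)) := by
      rw [mul_one_div, inv_eq_one_div, div_le_div_iff₀ ht0 (by positivity)]
      linarith
    linarith

open Set in
lemma neg_eq_thorin_exponent {U : Measure ℝ} (hU0 : U (Iic 0) = 0) {a s l : ℝ} (ha : 0 ≤ a)
    (hs : 0 ≤ s) (hl : 0 ≤ l) (h : ENNReal.ofReal l
      = ENNReal.ofReal (a * s) + ∫⁻ t, ENNReal.ofReal (log ((t + s) / t)) ∂U) :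
    -l = -(a * s) + ∫ t in Ioi (0:ℝ), log (t / (t + s)) ∂U := by
  have hpos : ∀ᵐ t ∂U, 0 < t := by
    rw [ae_iff]
    convert hU0 using 2
    ext; simp
  rw [Measure.restrict_eq_self_of_ae_mem (s := Ioi 0) hpos]
  have e : ∫ t, log (t / (t + s)) ∂U = -∫ t, log ((t + s) / t) ∂U := by
    rw [← integral_neg]
    refine integral_congr_ae (ae_of_all _ fun t => ?_)
    simp only
    rw [← log_inv, inv_div]
  rw [e, integral_eq_lintegral_of_nonneg_ae]
  · have h1 := congrArg ENNReal.toReal h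
    rw [ENNReal.toReal_ofReal hl, ENNReal.toReal_add ENNReal.ofReal_ne_top,
      ENNReal.toReal_ofReal (by positivity)] at h1
    · linarith
    · intro h2
      rw [h2] at h
      simp at h
  · filter_upwards [hpos] with t ht
    refine log_nonneg ?_
    rw [one_le_div ht]
    linarith
  · exact Measurable.aestronglyMeasurable (by fun_prop)

open Set in
lemma lintegral_powDensityMeasure_rpow_neg {k : ℝ} {f : ℝ → ℝ} (hfm : Measurable f)
    (hf0 : ∀ x, 0 ≤ f x) {s : ℝ} (hs : 0 ≤ s) :
    ∫⁻ x, ENNReal.ofReal ((x + s) ^ (-k)) ∂(powDensityMeasure k f)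
      = ∫⁻ x in Ioi 0, ENNReal.ofReal (f x * (x / (x + s)) ^ k) := by
  unfold powDensityMeasure
  rw [lintegral_withDensity_eq_lintegral_mul _ (by fun_prop) (by fun_prop)]
  refine setLIntegral_congr_fun measurableSet_Ioi fun x (hx : 0 < x) => ?_
  rw [Pi.mul_apply, ← ENNReal.ofReal_mul (mul_nonneg (hf0 x) (by positivity)), mul_assoc,
    rpow_neg (by positivity), div_rpow hx.le (by positivity), div_eq_mul_inv]

open Set in
lemma lintegral_powDensityMeasure_rpow_neg_zero {k : ℝ} {f : ℝ → ℝ} (hfm : Measurable f)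
    (hf0 : ∀ x, 0 ≤ f x) (hf1 : ∫⁻ x in Ioi 0, ENNReal.ofReal (f x) = 1) :
    ∫⁻ x, ENNReal.ofReal (x ^ (-k)) ∂(powDensityMeasure k f) = 1 := by
  have := lintegral_powDensityMeasure_rpow_neg (k := k) hfm hf0 le_rfl
  simp only [add_zero] at this
  rw [this, ← hf1]
  refine setLIntegral_congr_fun measurableSet_Ioi fun x (hx : 0 < x) => ?_
  rw [div_self hx.ne', one_rpow, mul_one]

open Set in
lemma continuousOn_integral_add_rpow_neg {k : ℝ} (hk : 0 < k) {f : ℝ → ℝ} (hfm : Measurable f)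
    (hf0 : ∀ x, 0 ≤ f x) (hf1 : ∫⁻ x in Ioi 0, ENNReal.ofReal (f x) = 1) :
    ContinuousOn (fun s => ∫ x, (x + s) ^ (-k) ∂(powDensityMeasure k f)) (Ici 0) := by
  have hpos := powDensityMeasure_ae_pos k f
  have h_integrable : Integrable (fun x : ℝ => x ^ (-k)) (powDensityMeasure k f) := by
    refine ⟨Measurable.aestronglyMeasurable (by fun_prop), ?_⟩
    rw [hasFiniteIntegral_iff_ofReal, lintegral_powDensityMeasure_rpow_neg_zero hfm hf0 hf1]
    · exact ENNReal.one_lt_top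
    · filter_upwards [hpos] with x hx using by positivity
  refine continuousOn_of_dominated (bound := fun x => x ^ (-k)) (fun s _ =>
    Measurable.aestronglyMeasurable (by fun_prop)) (fun s (hs : 0 ≤ s) => ?_) h_integrable ?_
  · filter_upwards [hpos] with x hx
    rw [Real.norm_of_nonneg (by positivity)]
    exact rpow_le_rpow_of_nonpos hx (by linarith) (by linarith)
  · filter_upwards [hpos] with x hx
    refine ContinuousOn.rpow_const (by fun_prop) fun s (hs : 0 ≤ s) => Or.inl ?_
    positivity

lemma hasDerivAt_neg_log_integral {k : ℝ} (hk : 0 < k) {f : ℝ → ℝ} (hfm : Measurable f)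
    (hf0 : ∀ x, 0 ≤ f x) (hf1 : ∫⁻ x in Set.Ioi 0, ENNReal.ofReal (f x) = 1) {s : ℝ} (hs : 0 < s) :
    HasDerivAt (fun s => -log (∫ x, (x + s) ^ (-k) ∂(powDensityMeasure k f)))
      ((thorinFunction k f s).re / s) s := by
  have h1 : HasDerivAt (stieltjesTransform k f) (deriv (stieltjesTransform k f) s) (s:ℂ) :=
    ((differentiableOn_stieltjesTransform hk hfm hf0 hf1).differentiableAt
      (Complex.isOpen_slitPlane.mem_nhds (Complex.ofReal_mem_slitPlane.2 hs))).hasDerivAt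
  have h2 := h1.real_of_complex
  have h3 : HasDerivAt (fun s : ℝ => ∫ x, (x + s) ^ (-k) ∂(powDensityMeasure k f))
      (deriv (stieltjesTransform k f) s).re s := by
    refine h2.congr_of_eventuallyEq ?_
    filter_upwards [Ioi_mem_nhds hs] with u (hu : 0 < u)
    rw [stieltjesTransform_ofReal hu.le, Complex.ofReal_re]
  have hp := stieltjesTransform_real_pos hk hfm hf0 hf1 hs
  have e : (thorinFunction k f s).re / s
      = -((deriv (stieltjesTransform k f) s).re / ∫ x, (x + s) ^ (-k) ∂(powDensityMeasure k f)) := by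
    rw [thorinFunction, stieltjesTransform_ofReal hs.le, Complex.neg_re, Complex.div_ofReal_re,
      Complex.re_ofReal_mul]
    field_simp
  rw [e]
  exact (h3.log hp.ne').neg

open Set in
theorem IsHMDensity.exists_thorin_measure {k : ℝ} (hk : 0 < k) {f : ℝ → ℝ} (hf : IsHMDensity k f)
    (hfm : Measurable f) :
    ∃ (a : ℝ) (U : Measure ℝ),
      0 ≤ a ∧ U (Iic 0) = 0 ∧
      (∀ r s : ℝ, 0 < r → U (Icc r s) < ⊤) ∧
      (∫⁻ t in Ioc (0:ℝ) 1, ENNReal.ofReal |log t| ∂U) < ⊤ ∧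
      (∫⁻ t in Ici (1:ℝ), ENNReal.ofReal t⁻¹ ∂U) < ⊤ ∧
      ∀ s : ℝ, 0 ≤ s → (∫ x, (x + s) ^ (-k) ∂(powDensityMeasure k f)) =
        exp (-(a * s) + ∫ t in Ioi (0:ℝ), log (t / (t + s)) ∂U) := by
  obtain ⟨ν, hν, hn⟩ := exists_finiteMeasure_of_im_mul_im_nonneg
    (hf.differentiableOn_thorinFunction hk hfm)
    (fun s hs => hf.thorinFunction_im_mul_im_nonneg hk hfm hs)
  have h0 : ∫ x, (x + 0) ^ (-k) ∂(powDensityMeasure k f) = 1 := by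
    simp only [add_zero]
    rw [integral_eq_lintegral_of_nonneg_ae,
      lintegral_powDensityMeasure_rpow_neg_zero hfm hf.1 hf.2.1, ENNReal.toReal_one]
    · filter_upwards [powDensityMeasure_ae_pos k f] with x hx
      simp only [Pi.zero_apply]
      positivity
    · exact Measurable.aestronglyMeasurable (by fun_prop)
  have hp : ∀ s, 0 ≤ s → 0 < ∫ x, (x + s) ^ (-k) ∂(powDensityMeasure k f) := fun s hs => by
    rcases hs.eq_or_lt with rfl | hs
    · rw [h0]; exact one_pos
    · exact stieltjesTransform_real_pos hk hfm hf.1 hf.2.1 hs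
  obtain ⟨a, U, ha, hU0, hU⟩ := _root_.exists_thorin_measure (ν := ν)
    (L := fun s => -log (∫ x, (x + s) ^ (-k) ∂(powDensityMeasure k f)))
    (n := fun s => (thorinFunction k f s).re)
    (((continuousOn_integral_add_rpow_neg hk hfm hf.1 hf.2.1).log fun s hs => (hp s hs).ne').neg)
    (by simp only [h0, log_one, neg_zero])
    (fun s hs => hasDerivAt_neg_log_integral hk hfm hf.1 hf.2.1 hs)
    (fun s hs => by simpa using hn s hs)
  have hW : ∫⁻ t, ENNReal.ofReal (log ((t + 1) / t)) ∂U ≠ ⊤ := fun h => by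
    have := (hU 1 zero_le_one).2
    rw [h] at this
    simp at this
  obtain ⟨c1, c2, c3⟩ := thorin_measure_conditions hW
  refine ⟨a, U, ha, hU0, c1, c2, c3, fun s hs => ?_⟩
  rw [← neg_eq_thorin_exponent hU0 ha hs (hU s hs).1 (hU s hs).2, neg_neg, exp_log (hp s hs)]

open Set in
lemma IsHMDensity.indicator_Ioi {l : ℝ} {f : ℝ → ℝ} (hf : IsHMDensity l f) :
    IsHMDensity l ((Ioi 0).indicator f) := by
  refine ⟨fun x => indicator_nonneg (fun x _ => hf.1 x) x, ?_, fun u hu => ?_⟩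
  · rw [← hf.2.1]
    refine setLIntegral_congr_fun measurableSet_Ioi fun x hx => ?_
    rw [indicator_of_mem hx]
  · obtain ⟨H, hH⟩ := hf.2.2 u hu
    refine ⟨H, fun v hv => ?_⟩
    rw [← hH v hv, indicator_of_mem (show u * v ∈ Ioi (0:ℝ) from mul_pos hu hv),
      indicator_of_mem (show u / v ∈ Ioi (0:ℝ) from div_pos hu hv)]

open Set in
lemma lintegral_gammaMeas_exp {k b : ℝ} (hk : 0 < k) (hb : 0 ≤ b) :
    ∫⁻ y, ENNReal.ofReal (exp (-(b * y))) ∂(gammaMeas k 1) = ENNReal.ofReal ((1 / (1 + b)) ^ k) := by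
  have hΓ := Real.Gamma_pos_of_pos hk
  have h1 : 0 < 1 + b := by positivity
  have hI := Real.integral_rpow_mul_exp_neg_mul_Ioi hk h1
  have h_integrable : IntegrableOn (fun t => t ^ (k - 1) * exp (-((1 + b) * t))) (Ioi 0) := by
    by_contra h
    rw [integral_undef h] at hI
    have : 0 < (1 / (1 + b)) ^ k * Real.Gamma k := by positivity
    linarith
  unfold gammaMeas
  rw [lintegral_withDensity_eq_lintegral_mul _ (by fun_prop) (by fun_prop)]
  have e : ∫⁻ y in Ioi 0, ((fun x => ENNReal.ofReal (1 ^ k / Real.Gamma k * x ^ (k - 1)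
        * exp (-(1 * x)))) * fun y => ENNReal.ofReal (exp (-(b * y)))) y
      = ∫⁻ y in Ioi 0, ENNReal.ofReal (Real.Gamma k)⁻¹
        * ENNReal.ofReal (y ^ (k - 1) * exp (-((1 + b) * y))) := by
    refine setLIntegral_congr_fun measurableSet_Ioi fun y (hy : 0 < y) => ?_
    rw [Pi.mul_apply, ← ENNReal.ofReal_mul (by positivity), ← ENNReal.ofReal_mul (by positivity),
      one_rpow, mul_assoc, ← exp_add]
    ring_nf
  rw [e, lintegral_const_mul _ (by fun_prop), ← ofReal_integral_eq_lintegral_ofReal h_integrable, hI,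
    ← ENNReal.ofReal_mul (by positivity)]
  · congr 1
    field_simp
  · exact (ae_restrict_iff' measurableSet_Ioi).2 (ae_of_all _ fun y (hy : 0 < y) => by
      simp only [Pi.zero_apply]; positivity)

open Set in
lemma lintegral_exp_neg_mul_div {Ω : Type*} [MeasurableSpace Ω] {P : Measure Ω}
    [IsProbabilityMeasure P] {k : ℝ} (hk : 0 < k) {Y X : Ω → ℝ} (hY : Measurable Y)
    (hX : Measurable X) (hYd : P.map Y = gammaMeas k 1) {f : ℝ → ℝ} (hfm : Measurable f)
    (hf0 : ∀ x, 0 ≤ f x) (hXd : HasDensityOn P X f) (hindep : IndepFun Y X P) {s : ℝ} (hs : 0 ≤ s) :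
    ∫⁻ ω, ENNReal.ofReal (exp (-s * (Y ω / X ω))) ∂P
      = ∫⁻ x, ENNReal.ofReal ((x + s) ^ (-k)) ∂(powDensityMeasure k f) := by
  have hprod := (indepFun_iff_map_prod_eq_prod_map_map hY.aemeasurable hX.aemeasurable).1 hindep
  have hm : Measurable fun p : ℝ × ℝ => ENNReal.ofReal (exp (-s * (p.1 / p.2))) := by fun_prop
  have := Measure.isProbabilityMeasure_map (μ := P) hY.aemeasurable
  have := Measure.isProbabilityMeasure_map (μ := P) hX.aemeasurable
  have h1 : ∫⁻ ω, ENNReal.ofReal (exp (-s * (Y ω / X ω))) ∂P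
      = ∫⁻ p, ENNReal.ofReal (exp (-s * (p.1 / p.2))) ∂(P.map fun ω => (Y ω, X ω)) := by
    rw [lintegral_map hm (hY.prodMk hX)]
  rw [h1, hprod, lintegral_prod_symm' _ hm, hYd, hXd, lintegral_powDensityMeasure_rpow_neg hfm hf0 hs,
    lintegral_withDensity_eq_lintegral_mul _ (by fun_prop) ?_]
  · refine setLIntegral_congr_fun measurableSet_Ioi fun x (hx : 0 < x) => ?_
    have e : ∀ y, -s * (y / x) = -(s / x * y) := fun y => by ring
    simp only [Pi.mul_apply, e]
    rw [lintegral_gammaMeas_exp hk (by positivity), ← ENNReal.ofReal_mul (hf0 x)]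
    congr 3
    field_simp
  · rw [← hYd]
    exact hm.lintegral_prod_left'

theorem gamma_div_HM_is_GGC
    {Ω : Type*} [MeasurableSpace Ω] (P : Measure Ω) [IsProbabilityMeasure P]
    (k l : ℝ) (hk : 0 < k) (hkl : k ≤ l)
    (Y X : Ω → ℝ) (hY : Measurable Y) (hX : Measurable X)
    (hYd : Measure.map Y P = gammaMeas k 1)
    (f : ℝ → ℝ) (hf : IsHMDensity l f) (hXd : HasDensityOn P X f)
    (hXpos : ∀ᵐ ω ∂P, 0 < X ω)
    (hindep : IndepFun Y X P) :
    IsGGC (Measure.map (fun ω => Y ω / X ω) P) := by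
  have hgm : Measurable ((Set.Ioi 0).indicator f) := hf.aemeasurable
  have hg : IsHMDensity k ((Set.Ioi 0).indicator f) := hf.indicator_Ioi.mono hk hkl
  have hXg : HasDensityOn P X ((Set.Ioi 0).indicator f) := by
    unfold HasDensityOn at hXd ⊢
    rw [hXd]
    refine withDensity_congr_ae ?_
    filter_upwards [ae_restrict_mem measurableSet_Ioi] with x hx
    rw [Set.indicator_of_mem hx]
  have hYX : Measurable fun ω => Y ω / X ω := hY.div hX
  obtain ⟨a, U, ha, hU0, c1, c2, c3, hU⟩ := hg.exists_thorin_measure hk hgm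
  refine ⟨Measure.isProbabilityMeasure_map hYX.aemeasurable, ?_, a, U, ha, hU0, c1, c2, c3,
    fun s hs => ?_⟩
  · have hYpos : ∀ᵐ ω ∂P, 0 < Y ω := by
      refine ae_of_ae_map hY.aemeasurable (p := fun y => 0 < y) ?_
      rw [hYd]
      exact (withDensity_absolutelyContinuous _ _).ae_le (ae_restrict_mem measurableSet_Ioi)
    rw [Measure.map_apply hYX measurableSet_Iio]
    have : ∀ᵐ ω ∂P, ¬ (Y ω / X ω < 0) := by
      filter_upwards [hYpos, hXpos] with ω h1 h2 using not_lt.2 (div_pos h1 h2).le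
    simpa [ae_iff] using! this
  · rw [← hU s hs, integral_map hYX.aemeasurable (Measurable.aestronglyMeasurable (by fun_prop)),
      integral_eq_lintegral_of_nonneg_ae (ae_of_all _ fun ω => (exp_pos _).le)
        (Measurable.aestronglyMeasurable (by fun_prop)),
      lintegral_exp_neg_mul_div hk hY hX hYd hgm hg.1 hXg hindep hs,
      integral_eq_lintegral_of_nonneg_ae]
    · filter_upwards [powDensityMeasure_ae_nonneg k ((Set.Ioi 0).indicator f)] with x hx
      simp only [Pi.zero_apply]
      positivity
    · exact Measurable.aestronglyMeasurable (by fun_prop)
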